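/- arXiv:2310.07420 — 3 statements merged into one kernel-verified Lean document; each statement's English description precedes it below -/
import Mathlib

section
/- Let (X,d) be a complete geodesic metric space and let u, v : X → ℝ be locally Lipschitz functions. If u − v attains a local maximum at a point x̂ ∈ X and v is C^{1,−}, then |∇u|(x̂) ≥ |∇v|(x̂). -/
open Filter Metric Set Topology

/-- Local slope of `u` at `x`, relative to a set `s` and a distance-like function `ρ`. -/
noncomputable def slopeWrt {α : Type*} [TopologicalSpace α] (s : Set α) (ρ : α → α → ℝ)
    (u : α → ℝ) (x : α) : ℝ :=
  Filter.limsup (fun y => |u y - u x| / ρ x y) (nhdsWithin x (s \ {x}))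

/-- Upper local slope. -/
noncomputable def upperSlopeWrt {α : Type*} [TopologicalSpace α] (s : Set α) (ρ : α → α → ℝ)
    (u : α → ℝ) (x : α) : ℝ :=
  Filter.limsup (fun y => max (u y - u x) 0 / ρ x y) (nhdsWithin x (s \ {x}))

/-- Lower local slope. -/
noncomputable def lowerSlopeWrt {α : Type*} [TopologicalSpace α] (s : Set α) (ρ : α → α → ℝ)
    (u : α → ℝ) (x : α) : ℝ :=
  Filter.limsup (fun y => max (u x - u y) 0 / ρ x y) (nhdsWithin x (s \ {x}))

/-- `u` is locally Lipschitz on `s` with respect to `ρ`. -/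
def LocLipWrt {α : Type*} [TopologicalSpace α] (s : Set α) (ρ : α → α → ℝ)
    (u : α → ℝ) : Prop :=
  ∀ x ∈ s, ∃ K : ℝ, ∃ t ∈ nhdsWithin x s, ∀ y ∈ t ∩ s, ∀ z ∈ t ∩ s, |u y - u z| ≤ K * ρ y z

/-- `u` is of class `C^{1,-}`: locally Lipschitz, with continuous local slope which
coincides with the lower local slope. -/
def IsC1MinusWrt {α : Type*} [TopologicalSpace α] (s : Set α) (ρ : α → α → ℝ)
    (u : α → ℝ) : Prop :=
  LocLipWrt s ρ u ∧ ContinuousOn (slopeWrt s ρ u) s ∧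
    ∀ x ∈ s, lowerSlopeWrt s ρ u x = slopeWrt s ρ u x

/-- `u` is of class `C^{1,+}`: locally Lipschitz, with continuous local slope which
coincides with the upper local slope. -/
def IsC1PlusWrt {α : Type*} [TopologicalSpace α] (s : Set α) (ρ : α → α → ℝ)
    (u : α → ℝ) : Prop :=
  LocLipWrt s ρ u ∧ ContinuousOn (slopeWrt s ρ u) s ∧
    ∀ x ∈ s, upperSlopeWrt s ρ u x = slopeWrt s ρ u x

/-- Upper semicontinuous envelope of `u` relative to `s`. -/
noncomputable def uscWrt {α : Type*} [TopologicalSpace α] (s : Set α) (u : α → ℝ) (x : α) : ℝ :=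
  Filter.limsup u (nhdsWithin x s)

/-- Lower semicontinuous envelope of `u` relative to `s`. -/
noncomputable def lscWrt {α : Type*} [TopologicalSpace α] (s : Set α) (u : α → ℝ) (x : α) : ℝ :=
  Filter.liminf u (nhdsWithin x s)

/-- `H_a(x,r,p) = inf { H x r q | q ≥ 0, |q - p| ≤ a }`. -/
noncomputable def Hlow {α : Type*} (H : α → ℝ → ℝ → ℝ) (a : ℝ) (x : α) (r p : ℝ) : ℝ :=
  sInf (H x r '' {q | 0 ≤ q ∧ |q - p| ≤ a})

/-- `H^a(x,r,p) = sup { H x r q | q ≥ 0, |q - p| ≤ a }`. -/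
noncomputable def Hupp {α : Type*} (H : α → ℝ → ℝ → ℝ) (a : ℝ) (x : α) (r p : ℝ) : ℝ :=
  sSup (H x r '' {q | 0 ≤ q ∧ |q - p| ≤ a})

/-- Metric viscosity subsolution of `H(x, u, |∇u|) = 0` on the space `(s, ρ)`. -/
def IsMVSubsolutionWrt {α : Type*} [TopologicalSpace α] (s : Set α) (ρ : α → α → ℝ)
    (H : α → ℝ → ℝ → ℝ) (u : α → ℝ) : Prop :=
  ∀ ψ₁ ψ₂ : α → ℝ, IsC1MinusWrt s ρ ψ₁ → LocLipWrt s ρ ψ₂ →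
    ∀ x ∈ s, IsLocalMaxOn (fun y => uscWrt s u y - (ψ₁ y + ψ₂ y)) s x →
      Hlow H (uscWrt s (slopeWrt s ρ ψ₂) x) x (uscWrt s u x) (slopeWrt s ρ ψ₁ x) ≤ 0

/-- Metric viscosity supersolution of `H(x, u, |∇u|) = 0` on the space `(s, ρ)`. -/
def IsMVSupersolutionWrt {α : Type*} [TopologicalSpace α] (s : Set α) (ρ : α → α → ℝ)
    (H : α → ℝ → ℝ → ℝ) (u : α → ℝ) : Prop :=
  ∀ ψ₁ ψ₂ : α → ℝ, IsC1PlusWrt s ρ ψ₁ → LocLipWrt s ρ ψ₂ →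
    ∀ x ∈ s, IsLocalMinOn (fun y => lscWrt s u y - (ψ₁ y + ψ₂ y)) s x →
      0 ≤ Hupp H (uscWrt s (slopeWrt s ρ ψ₂) x) x (lscWrt s u x) (slopeWrt s ρ ψ₁ x)

/-- `(s, ρ)` is a geodesic space: any two points are joined by an isometric
embedding of the interval `[0, ρ x y]`. -/
def IsGeodesicWrt {α : Type*} (s : Set α) (ρ : α → α → ℝ) : Prop :=
  ∀ x ∈ s, ∀ y ∈ s, ∃ γ : ℝ → α, γ 0 = x ∧ γ (ρ x y) = y ∧
    (∀ t ∈ Icc (0:ℝ) (ρ x y), γ t ∈ s) ∧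
    ∀ t₁ ∈ Icc (0:ℝ) (ρ x y), ∀ t₂ ∈ Icc (0:ℝ) (ρ x y), ρ (γ t₁) (γ t₂) = |t₁ - t₂|

/-- Strict local maximum of `f` on `s` at `x`. -/
def IsStrictLocalMaxOn' {α : Type*} [TopologicalSpace α] (f : α → ℝ) (s : Set α) (x : α) : Prop :=
  ∀ᶠ y in nhdsWithin x (s \ {x}), f y < f x

/-- Strict local minimum of `f` on `s` at `x`. -/
def IsStrictLocalMinOn' {α : Type*} [TopologicalSpace α] (f : α → ℝ) (s : Set α) (x : α) : Prop :=
  ∀ᶠ y in nhdsWithin x (s \ {x}), f x < f y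

/-- `u` is locally bounded on `s`. -/
def LocBddWrt {α : Type*} [TopologicalSpace α] (s : Set α) (u : α → ℝ) : Prop :=
  ∀ x ∈ s, ∃ C : ℝ, ∀ᶠ y in nhdsWithin x s, |u y| ≤ C

/-- `ρ` is a metric on the subset `S` of the ambient metric space `Y`, bounded below by the
ambient distance and inducing the subspace topology on `S`. -/
structure IsMetricOn {Y : Type*} [MetricSpace Y] (S : Set Y) (ρ : Y → Y → ℝ) : Prop where
  refl : ∀ x ∈ S, ρ x x = 0
  symm : ∀ x ∈ S, ∀ y ∈ S, ρ x y = ρ y x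
  triangle : ∀ x ∈ S, ∀ y ∈ S, ∀ z ∈ S, ρ x z ≤ ρ x y + ρ y z
  ge_dist : ∀ x ∈ S, ∀ y ∈ S, dist x y ≤ ρ x y
  nhds_basis : ∀ x ∈ S, (nhdsWithin x S).HasBasis (fun ε : ℝ => 0 < ε)
    (fun ε => {y | y ∈ S ∧ ρ x y < ε})

/-- Spatial local slope of `ψ : (0,∞) × X → ℝ` at `z = (t, x)`. -/
noncomputable def slopeSpWrt {α : Type*} [TopologicalSpace α] (s : Set α) (ρ : α → α → ℝ)
    (ψ : ℝ × α → ℝ) (z : ℝ × α) : ℝ :=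
  Filter.limsup (fun y => |ψ (z.1, y) - ψ z| / ρ z.2 y) (nhdsWithin z.2 (s \ {z.2}))

/-- Spatial upper local slope. -/
noncomputable def upperSlopeSpWrt {α : Type*} [TopologicalSpace α] (s : Set α) (ρ : α → α → ℝ)
    (ψ : ℝ × α → ℝ) (z : ℝ × α) : ℝ :=
  Filter.limsup (fun y => max (ψ (z.1, y) - ψ z) 0 / ρ z.2 y) (nhdsWithin z.2 (s \ {z.2}))

/-- Spatial lower local slope. -/
noncomputable def lowerSlopeSpWrt {α : Type*} [TopologicalSpace α] (s : Set α) (ρ : α → α → ℝ)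
    (ψ : ℝ × α → ℝ) (z : ℝ × α) : ℝ :=
  Filter.limsup (fun y => max (ψ z - ψ (z.1, y)) 0 / ρ z.2 y) (nhdsWithin z.2 (s \ {z.2}))

/-- Product (max) metric on `ℝ × α` built from `ρ`. -/
def prodMet {α : Type*} (ρ : α → α → ℝ) : ℝ × α → ℝ × α → ℝ :=
  fun z w => max |z.1 - w.1| (ρ z.2 w.2)

/-- Metric viscosity subsolution of `∂ₜ u + H(t, x, u, |∇u|) = 0` on `(0,∞) × (s, ρ)`. -/
def IsMVSubsolutionTWrt {α : Type*} [TopologicalSpace α] (s : Set α) (ρ : α → α → ℝ)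
    (H : ℝ → α → ℝ → ℝ → ℝ) (u : ℝ × α → ℝ) : Prop :=
  ∀ ψ₁ ψ₂ dψ₁ dψ₂ : ℝ × α → ℝ,
    LocLipWrt (Ioi (0:ℝ) ×ˢ s) (prodMet ρ) ψ₁ →
    LocLipWrt (Ioi (0:ℝ) ×ˢ s) (prodMet ρ) ψ₂ →
    (∀ z ∈ Ioi (0:ℝ) ×ˢ s, HasDerivAt (fun τ => ψ₁ (τ, z.2)) (dψ₁ z) z.1) →
    ContinuousOn dψ₁ (Ioi (0:ℝ) ×ˢ s) →
    (∀ z ∈ Ioi (0:ℝ) ×ˢ s, HasDerivAt (fun τ => ψ₂ (τ, z.2)) (dψ₂ z) z.1) →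
    ContinuousOn dψ₂ (Ioi (0:ℝ) ×ˢ s) →
    ContinuousOn (slopeSpWrt s ρ ψ₁) (Ioi (0:ℝ) ×ˢ s) →
    (∀ z ∈ Ioi (0:ℝ) ×ˢ s, lowerSlopeSpWrt s ρ ψ₁ z = slopeSpWrt s ρ ψ₁ z) →
    ∀ z ∈ Ioi (0:ℝ) ×ˢ s,
      IsLocalMaxOn (fun w => uscWrt (Ioi (0:ℝ) ×ˢ s) u w - (ψ₁ w + ψ₂ w))
        (Ioi (0:ℝ) ×ˢ s) z →
      dψ₁ z + dψ₂ z +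
        Hlow (fun w : ℝ × α => H w.1 w.2)
          (uscWrt (Ioi (0:ℝ) ×ˢ s) (slopeSpWrt s ρ ψ₂) z) z
          (uscWrt (Ioi (0:ℝ) ×ˢ s) u z) (slopeSpWrt s ρ ψ₁ z) ≤ 0

/-- Metric viscosity supersolution of `∂ₜ u + H(t, x, u, |∇u|) = 0` on `(0,∞) × (s, ρ)`. -/
def IsMVSupersolutionTWrt {α : Type*} [TopologicalSpace α] (s : Set α) (ρ : α → α → ℝ)
    (H : ℝ → α → ℝ → ℝ → ℝ) (u : ℝ × α → ℝ) : Prop :=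
  ∀ ψ₁ ψ₂ dψ₁ dψ₂ : ℝ × α → ℝ,
    LocLipWrt (Ioi (0:ℝ) ×ˢ s) (prodMet ρ) ψ₁ →
    LocLipWrt (Ioi (0:ℝ) ×ˢ s) (prodMet ρ) ψ₂ →
    (∀ z ∈ Ioi (0:ℝ) ×ˢ s, HasDerivAt (fun τ => ψ₁ (τ, z.2)) (dψ₁ z) z.1) →
    ContinuousOn dψ₁ (Ioi (0:ℝ) ×ˢ s) →
    (∀ z ∈ Ioi (0:ℝ) ×ˢ s, HasDerivAt (fun τ => ψ₂ (τ, z.2)) (dψ₂ z) z.1) →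
    ContinuousOn dψ₂ (Ioi (0:ℝ) ×ˢ s) →
    ContinuousOn (slopeSpWrt s ρ ψ₁) (Ioi (0:ℝ) ×ˢ s) →
    (∀ z ∈ Ioi (0:ℝ) ×ˢ s, upperSlopeSpWrt s ρ ψ₁ z = slopeSpWrt s ρ ψ₁ z) →
    ∀ z ∈ Ioi (0:ℝ) ×ˢ s,
      IsLocalMinOn (fun w => lscWrt (Ioi (0:ℝ) ×ˢ s) u w - (ψ₁ w + ψ₂ w))
        (Ioi (0:ℝ) ×ˢ s) z →
      0 ≤ dψ₁ z + dψ₂ z +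
        Hupp (fun w : ℝ × α => H w.1 w.2)
          (uscWrt (Ioi (0:ℝ) ×ˢ s) (slopeSpWrt s ρ ψ₂) z) z
          (lscWrt (Ioi (0:ℝ) ×ˢ s) u z) (slopeSpWrt s ρ ψ₁ z)

/-- The difference quotients of a locally Lipschitz function are bounded near each point. -/
theorem LocLipWrt.isBoundedUnder_quotient {X : Type*} [MetricSpace X] {u : X → ℝ}
    (hu : LocLipWrt (univ : Set X) dist u) (x : X) :
    IsBoundedUnder (· ≤ ·) (𝓝[univ \ {x}] x) (fun y => |u y - u x| / dist x y) := by
  obtain ⟨K, t, ht, hK⟩ := hu x (mem_univ x)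
  rw [nhdsWithin_univ] at ht
  refine isBoundedUnder_of_eventually_le (a := K) ?_
  filter_upwards [mem_nhdsWithin_of_mem_nhds ht, self_mem_nhdsWithin] with y hy hyx
  have hpos : 0 < dist x y := dist_pos.2 (Ne.symm hyx.2)
  rw [div_le_iff₀ hpos, dist_comm]
  exact hK y ⟨hy, mem_univ y⟩ x ⟨mem_of_mem_nhds ht, mem_univ x⟩

/-- maximum principle, first item. -/
theorem stmt0 {X : Type*} [MetricSpace X] [CompleteSpace X]
    (hgeo : IsGeodesicWrt (univ : Set X) dist)
    (u v : X → ℝ)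
    (hu : LocLipWrt (univ : Set X) dist u) (hv : LocLipWrt (univ : Set X) dist v)
    (xhat : X) (hmax : IsLocalMax (fun x => u x - v x) xhat)
    (hvC : IsC1MinusWrt (univ : Set X) dist v) :
    slopeWrt (univ : Set X) dist v xhat ≤ slopeWrt (univ : Set X) dist u xhat := by
  rw [← hvC.2.2 xhat (mem_univ xhat)]
  unfold lowerSlopeWrt slopeWrt
  rcases eq_or_neBot (𝓝[univ \ {xhat}] xhat) with hbot | hne
  · simp [hbot, limsup_eq]
  · refine limsup_le_limsup ?_ ?_ (hu.isBoundedUnder_quotient xhat)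
    · filter_upwards [mem_nhdsWithin_of_mem_nhds hmax] with y hy
      have hy : u y - v y ≤ u xhat - v xhat := hy
      gcongr
      refine max_le ?_ (abs_nonneg _)
      linarith [neg_abs_le (u y - u xhat)]
    · exact (isBoundedUnder_of_eventually_ge (a := 0) (Eventually.of_forall fun y =>
        div_nonneg (le_max_right _ _) dist_nonneg)).isCoboundedUnder_le
end

section
/- Let H : ℝ^d × ℝ × [0,∞) → ℝ be continuous and let u : ℝ^d → ℝ be locally bounded. Suppose that for all â, x̂ ∈ ℝ^d and k ≥ 0, if x ↦ u*(x) − (k/2)|x − â|² attains a local maximum at x = x̂, then H(x̂, u*(x̂), k·|x̂ − â|) ≤ 0, where u* is the upper semicontinuous envelope of u and |·| is the Euclidean norm. Then u is a classical viscosity subsolution of H(x, u, |∇u|) = 0 on ℝ^d: for every C¹ function φ : ℝ^d → ℝ, if u* − φ attains a local maximum at x̂ ∈ ℝ^d, then H(x̂, u*(x̂), |∇φ(x̂)|) ≤ 0. -/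
open Filter Metric Set Topology

/-- The upper semicontinuous envelope of a locally bounded function is upper semicontinuous. -/
theorem upperSemicontinuous_uscWrt_univ {α : Type*} [TopologicalSpace α] {u : α → ℝ}
    (hu : LocBddWrt univ u) : UpperSemicontinuous (uscWrt univ u) := by
  have bdd (x : α) : ∃ C : ℝ, ∀ᶠ y in 𝓝 x, |u y| ≤ C := by
    simpa using hu x (mem_univ x)
  intro x c hc
  simp only [uscWrt, nhdsWithin_univ] at hc ⊢
  obtain ⟨c', hxc', hc'c⟩ := exists_between hc
  obtain ⟨C, hC⟩ := bdd x
  have hlt : ∀ᶠ y in 𝓝 x, u y < c' :=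
    eventually_lt_of_limsup_lt hxc' ⟨C, hC.mono fun y hy => (abs_le.1 hy).2⟩
  filter_upwards [hlt.eventually_nhds] with y hy
  obtain ⟨D, hD⟩ := bdd y
  have hcobdd : IsCoboundedUnder (· ≤ ·) (𝓝 y) u :=
    IsBoundedUnder.isCoboundedUnder_le ⟨-D, hD.mono fun z hz => (abs_le.1 hz).1⟩
  exact (limsup_le_of_le hcobdd (hy.mono fun z hz => hz.le)).trans_lt hc'c

/-- Completing the square: the affine function of slope `p` plus `k / 2` times the squared
distance to `x₀` is, up to a constant, `k / 2` times the squared distance to `x₀ - k⁻¹ • p`. -/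
theorem half_mul_dist_sub_inv_smul_sq {E : Type*} [NormedAddCommGroup E] [InnerProductSpace ℝ E]
    {k : ℝ} (hk : k ≠ 0) (p x₀ x : E) :
    k / 2 * dist (x₀ - k⁻¹ • p) x ^ 2 =
      inner ℝ p (x - x₀) + k / 2 * ‖x - x₀‖ ^ 2 + ‖p‖ ^ 2 / (2 * k) := by
  have h : x - (x₀ - k⁻¹ • p) = (x - x₀) + k⁻¹ • p := by abel
  rw [dist_comm, dist_eq_norm, h, norm_add_sq_real, inner_smul_right, norm_smul, mul_pow,
    Real.norm_eq_abs, sq_abs, real_inner_comm]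
  field_simp
  ring

/-- If `w - φ` has a local maximum at `x₀` and `φ` has gradient `p` there, then there are points
arbitrarily close to `x₀` at which `w` is touched from above by a multiple of a squared distance,
with the value of `w` and the slope arbitrarily close to `w x₀` and `‖p‖`. -/
theorem exists_isLocalMax_sub_sq_dist {E : Type*} [NormedAddCommGroup E] [InnerProductSpace ℝ E]
    [ProperSpace E] {w φ : E → ℝ} (hw : UpperSemicontinuous w) {x₀ p : E}
    (hφ : HasGradientAt φ p x₀) (hmax : IsLocalMax (fun x => w x - φ x) x₀)
    {ε : ℝ} (hε : 0 < ε) :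
    ∃ (a x : E) (k : ℝ), 0 ≤ k ∧ IsLocalMax (fun y => w y - k / 2 * dist a y ^ 2) x ∧
      dist x x₀ < ε ∧ |w x - w x₀| < ε ∧ |k * dist a x - ‖p‖| < ε := by
  have hupper : ∀ᶠ x in 𝓝 x₀, w x ≤ w x₀ + inner ℝ p (x - x₀) + ε / 4 * ‖x - x₀‖ := by
    have hlin := (hasGradientAt_iff_isLittleO.1 hφ).bound (show 0 < ε / 4 by positivity)
    filter_upwards [hlin, hmax] with x hx hx'
    have := (abs_le.1 hx).2
    linarith
  obtain ⟨δ, hδ, hball⟩ := Metric.eventually_nhds_iff.1 hupper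
  obtain ⟨r, hr, hrlt⟩ : ∃ r : ℝ, 0 < r ∧ r < min (min δ ε) (ε / (‖p‖ + ε)) :=
    exists_between (by positivity)
  simp only [lt_min_iff] at hrlt
  obtain ⟨⟨hrδ, hrε⟩, hrp⟩ := hrlt
  rw [lt_div_iff₀ (by positivity)] at hrp
  have hk : 0 < ε / r := by positivity
  set k := ε / r
  have hkr : k * r = ε := div_mul_cancel₀ _ hr.ne'
  set a := x₀ - k⁻¹ • p
  set g : E → ℝ := fun y => w y - k / 2 * dist a y ^ 2 with hg
  have hgeq (y : E) : g y =
      w y - (inner ℝ p (y - x₀) + k / 2 * ‖y - x₀‖ ^ 2 + ‖p‖ ^ 2 / (2 * k)) := by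
    rw [hg, ← half_mul_dist_sub_inv_smul_sq hk.ne']
  have hgusc : UpperSemicontinuous g := by
    have hc : Continuous fun y : E => -(k / 2 * dist a y ^ 2) := by fun_prop
    simpa only [hg, sub_eq_add_neg] using hw.add hc.upperSemicontinuous
  obtain ⟨x, hxmem, hxmax⟩ := (hgusc.upperSemicontinuousOn _).exists_isMaxOn
    ⟨x₀, mem_closedBall_self hr.le⟩ (isCompact_closedBall x₀ r)
  have hge : g x₀ ≤ g x := hxmax (mem_closedBall_self hr.le)
  rw [hgeq, hgeq, sub_self, inner_zero_right, norm_zero] at hge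
  have hxr : ‖x - x₀‖ ≤ r := by simpa [dist_eq_norm] using hxmem
  have hub := hball (show dist x x₀ < δ by rw [dist_eq_norm]; linarith)
  have hxlt : ‖x - x₀‖ < r := by
    refine hxr.lt_of_ne fun heq => ?_
    rw [heq] at hge hub
    nlinarith [mul_pos hε hr]
  refine ⟨a, x, k, hk.le, ?_, by rw [dist_eq_norm]; linarith, ?_, ?_⟩
  · exact hxmax.isLocalMax (closedBall_mem_nhds_of_mem (by simpa [dist_eq_norm] using hxlt))
  · have hin := abs_le.1 (abs_real_inner_le_norm p (x - x₀))
    have hpr : ‖p‖ * ‖x - x₀‖ ≤ ‖p‖ * r := by gcongr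
    have hεr : ε * ‖x - x₀‖ ≤ ε * r := by gcongr
    have hsq : 0 ≤ k / 2 * ‖x - x₀‖ ^ 2 := by positivity
    have hεr' : 0 < ε * r := by positivity
    rw [abs_lt]
    constructor <;> linarith
  · have hslope : k * dist a x = ‖k • (x - x₀) + p‖ := by
      have h : k • (x - x₀) + p = k • (x - a) := by
        simp only [a, smul_sub, smul_inv_smul₀ hk.ne']
        abel
      rw [h, norm_smul, Real.norm_of_nonneg hk.le, dist_comm, dist_eq_norm]
    calc |k * dist a x - ‖p‖| ≤ ‖k • (x - x₀) + p - p‖ := by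
          rw [hslope]; exact abs_norm_sub_norm_le _ _
      _ = k * ‖x - x₀‖ := by
          rw [add_sub_cancel_right, norm_smul, Real.norm_of_nonneg hk.le]
      _ < k * r := by gcongr
      _ = ε := hkr

/-- in Euclidean space, the squared-distance test condition implies the
classical viscosity subsolution property. -/
theorem stmt7 {d : ℕ}
    (H : EuclideanSpace ℝ (Fin d) → ℝ → ℝ → ℝ)
    (hH : ContinuousOn (fun q : EuclideanSpace ℝ (Fin d) × ℝ × ℝ => H q.1 q.2.1 q.2.2)
      ((univ : Set (EuclideanSpace ℝ (Fin d))) ×ˢ (univ : Set ℝ) ×ˢ Ici (0:ℝ)))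
    (u : EuclideanSpace ℝ (Fin d) → ℝ)
    (hu : LocBddWrt (univ : Set (EuclideanSpace ℝ (Fin d))) u)
    (hyp : ∀ a xhat : EuclideanSpace ℝ (Fin d), ∀ k : ℝ, 0 ≤ k →
      IsLocalMax
        (fun x => uscWrt (univ : Set (EuclideanSpace ℝ (Fin d))) u x - k / 2 * dist a x ^ 2)
        xhat →
      H xhat (uscWrt (univ : Set (EuclideanSpace ℝ (Fin d))) u xhat) (k * dist a xhat) ≤ 0) :
    ∀ φ : EuclideanSpace ℝ (Fin d) → ℝ, ContDiff ℝ 1 φ →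
      ∀ xhat : EuclideanSpace ℝ (Fin d),
        IsLocalMax (fun x => uscWrt (univ : Set (EuclideanSpace ℝ (Fin d))) u x - φ x) xhat →
        H xhat (uscWrt (univ : Set (EuclideanSpace ℝ (Fin d))) u xhat) ‖gradient φ xhat‖ ≤ 0 := by
  intro φ hφ xhat hmax
  set w := uscWrt (univ : Set (EuclideanSpace ℝ (Fin d))) u
  have hgrad : HasGradientAt φ (gradient φ xhat) xhat :=
    (hφ.differentiable one_ne_zero xhat).hasGradientAt
  by_contra! hpos
  have hcont := hH (xhat, w xhat, ‖gradient φ xhat‖)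
    ⟨mem_univ _, mem_univ _, norm_nonneg _⟩
  obtain ⟨ε, hε, hsub⟩ := Metric.mem_nhdsWithin_iff.1 (hcont (lt_mem_nhds hpos))
  obtain ⟨a, x, k, hk, hx, hdist, hval, hslope⟩ :=
    exists_isLocalMax_sub_sq_dist (upperSemicontinuous_uscWrt_univ hu) hgrad hmax hε
  have hball : (x, w x, k * dist a x) ∈ ball (xhat, w xhat, ‖gradient φ xhat‖) ε := by
    simp only [mem_ball, Prod.dist_eq, max_lt_iff, Real.dist_eq]
    exact ⟨hdist, hval, hslope⟩
  have hmem : k * dist a x ∈ Ici (0 : ℝ) := mul_nonneg hk dist_nonneg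
  exact (hyp a x k hk hx).not_gt (hsub ⟨hball, mem_univ _, mem_univ _, hmem⟩)
end

section
/- Under the stability setup with hypotheses (H1), (H2), (H3), suppose for each n ∈ ℕ the function u^n : X_n → ℝ is a metric viscosity subsolution of H_n(x, u^n, |∇_{d_n} u^n|) = 0 on the geodesic space (X_n, d_n), and the family (u^n) is uniformly bounded. Then the upper semilimit ū(x) := sup{ limsup_{n→∞} u^n(x_n) : x_n ∈ X_n, 𝖽(x_n, x) → 0 }, defined for x ∈ X_∞, is a metric viscosity subsolution of H_∞(x, ū, |∇_{d_∞} ū|) = 0 on (X_∞, d_∞). -/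
open Filter Metric Set Topology

theorem limsup_le_of_eventually_nonneg {α : Type*} {F : Filter α} {f : α → ℝ} {c : ℝ}
    (hc : 0 ≤ c) (h0 : ∀ᶠ x in F, 0 ≤ f x) (h : ∀ᶠ x in F, f x ≤ c) : limsup f F ≤ c := by
  rcases F.eq_or_neBot with rfl | hF
  · simpa [limsup, limsSup] using hc
  · exact limsup_le_of_le (isCoboundedUnder_le_of_eventually_le _ h0) h

theorem le_limsup_of_frequently_of_eventually {α : Type*} {F : Filter α} {f : α → ℝ} {b c : ℝ}
    (hb : ∃ᶠ x in F, b ≤ f x) (hc : ∀ᶠ x in F, f x ≤ c) : b ≤ limsup f F :=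
  le_limsup_of_frequently_le hb (isBoundedUnder_of_eventually_le hc)

theorem limsup_nonneg_of_eventually {α : Type*} {F : Filter α} {f : α → ℝ} {c : ℝ}
    (h0 : ∀ᶠ x in F, 0 ≤ f x) (h : ∀ᶠ x in F, f x ≤ c) : 0 ≤ limsup f F := by
  rcases F.eq_or_neBot with rfl | hF
  · simp [limsup, limsSup]
  · exact le_limsup_of_frequently_of_eventually h0.frequently h

/-! ### Upper semicontinuous envelopes of bounded functions -/

section Envelope

variable {Y : Type*} [TopologicalSpace Y] {S : Set Y} {u : Y → ℝ} {C c : ℝ} {x : Y}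

theorem neBot_nhdsWithin_of_mem (hx : x ∈ S) : (𝓝[S] x).NeBot :=
  mem_closure_iff_nhdsWithin_neBot.1 (subset_closure hx)

theorem uscWrt_le (hu : ∀ y ∈ S, |u y| ≤ C) (hx : x ∈ S) (h : ∀ᶠ y in 𝓝[S] x, u y ≤ c) :
    uscWrt S u x ≤ c := by
  have := neBot_nhdsWithin_of_mem hx
  refine limsup_le_of_le (isCoboundedUnder_le_of_eventually_le _ (x := -C) ?_) h
  filter_upwards [self_mem_nhdsWithin] with y hy using (abs_le.1 (hu y hy)).1

theorem isBoundedUnder_of_abs_le (hu : ∀ y ∈ S, |u y| ≤ C) :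
    (𝓝[S] x).IsBoundedUnder (· ≤ ·) u :=
  isBoundedUnder_of_eventually_le (a := C)
    (by filter_upwards [self_mem_nhdsWithin] with y hy using (abs_le.1 (hu y hy)).2)

theorem le_uscWrt (hu : ∀ y ∈ S, |u y| ≤ C) (hx : x ∈ S) : u x ≤ uscWrt S u x := by
  refine le_limsup_of_frequently_le ?_ (isBoundedUnder_of_abs_le hu)
  intro h
  exact (mem_of_mem_nhdsWithin hx h : ¬ (u x ≤ u x)) le_rfl

theorem eventually_lt_of_uscWrt_lt (hu : ∀ y ∈ S, |u y| ≤ C) (h : uscWrt S u x < c) :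
    ∀ᶠ y in 𝓝[S] x, u y < c :=
  eventually_lt_of_limsup_lt h (isBoundedUnder_of_abs_le hu)

theorem frequently_lt_of_lt_uscWrt (hu : ∀ y ∈ S, |u y| ≤ C) (hx : x ∈ S)
    (h : c < uscWrt S u x) : ∃ᶠ y in 𝓝[S] x, c < u y := by
  have := neBot_nhdsWithin_of_mem hx
  refine frequently_lt_of_lt_limsup (isCoboundedUnder_le_of_eventually_le _ (x := -C) ?_) h
  filter_upwards [self_mem_nhdsWithin] with y hy using (abs_le.1 (hu y hy)).1

theorem abs_uscWrt_le (hu : ∀ y ∈ S, |u y| ≤ C) (hx : x ∈ S) : |uscWrt S u x| ≤ C := by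
  rw [abs_le]
  refine ⟨(abs_le.1 (hu x hx)).1.trans (le_uscWrt hu hx), uscWrt_le hu hx ?_⟩
  filter_upwards [self_mem_nhdsWithin] with y hy using (abs_le.1 (hu y hy)).2

theorem upperSemicontinuousOn_uscWrt (hu : ∀ y ∈ S, |u y| ≤ C) :
    UpperSemicontinuousOn (uscWrt S u) S := by
  intro x hx c hc
  obtain ⟨b, hb, hbc⟩ := exists_between hc
  have h := eventually_eventually_nhdsWithin.2 (eventually_lt_of_uscWrt_lt hu hb)
  filter_upwards [h, self_mem_nhdsWithin] with y hy hyS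
  exact (uscWrt_le hu hyS (hy.mono fun _ hz => hz.le)).trans_lt hbc

theorem uscWrt_eq_of_continuousOn (hu : ContinuousOn u S) (hx : x ∈ S) :
    uscWrt S u x = u x := by
  have := neBot_nhdsWithin_of_mem hx
  exact (hu x hx).limsup_eq

end Envelope

/-! ### Metrics on subsets -/

section Metric

variable {Y : Type*} [MetricSpace Y] {S : Set Y} {ρ : Y → Y → ℝ}

theorem IsMetricOn.nonneg (h : IsMetricOn S ρ) {x y : Y} (hx : x ∈ S) (hy : y ∈ S) :
    0 ≤ ρ x y :=
  dist_nonneg.trans (h.ge_dist x hx y hy)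

theorem IsMetricOn.pos (h : IsMetricOn S ρ) {x y : Y} (hx : x ∈ S) (hy : y ∈ S) (hxy : x ≠ y) :
    0 < ρ x y :=
  (dist_pos.2 hxy).trans_le (h.ge_dist x hx y hy)

theorem IsMetricOn.abs_sub_le (h : IsMetricOn S ρ) {x y x' y' : Y} (hx : x ∈ S) (hy : y ∈ S)
    (hx' : x' ∈ S) (hy' : y' ∈ S) : |ρ x' y' - ρ x y| ≤ ρ x x' + ρ y y' := by
  rw [abs_le]
  constructor
  · linarith [h.triangle x hx x' hx' y hy, h.triangle x' hx' y' hy' y hy, h.symm y' hy' y hy]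
  · linarith [h.triangle x' hx' x hx y' hy', h.triangle x hx y hy y' hy', h.symm x' hx' x hx]

theorem IsMetricOn.tendsto_zero (h : IsMetricOn S ρ) {ι : Type*} {l : Filter ι} {f : ι → Y}
    {x : Y} (hx : x ∈ S) (hf : Tendsto f l (𝓝[S] x)) : Tendsto (fun i => ρ x (f i)) l (𝓝 0) := by
  rw [Metric.tendsto_nhds]
  intro ε hε
  filter_upwards [hf.eventually ((h.nhds_basis x hx).mem_of_mem hε)] with i hi
  rw [Real.dist_eq, sub_zero, abs_of_nonneg (h.nonneg hx hi.1)]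
  exact hi.2

theorem IsMetricOn.tendsto (h : IsMetricOn S ρ) {ι : Type*} {l : Filter ι} {f g : ι → Y}
    {x y : Y} (hx : x ∈ S) (hy : y ∈ S) (hf : Tendsto f l (𝓝[S] x)) (hg : Tendsto g l (𝓝[S] y)) :
    Tendsto (fun i => ρ (f i) (g i)) l (𝓝 (ρ x y)) := by
  rw [tendsto_iff_dist_tendsto_zero]
  have h0 := (h.tendsto_zero hx hf).add (h.tendsto_zero hy hg)
  rw [add_zero] at h0
  refine squeeze_zero' (Eventually.of_forall fun _ => dist_nonneg) ?_ h0
  filter_upwards [hf.eventually self_mem_nhdsWithin, hg.eventually self_mem_nhdsWithin]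
    with i hi hi'
  exact h.abs_sub_le hx hy hi hi'

theorem IsMetricOn.continuousOn (h : IsMetricOn S ρ) {Z : Type*} [TopologicalSpace Z] {T : Set Z}
    {f g : Z → Y} (hf : ContinuousOn f T) (hg : ContinuousOn g T) (hfS : MapsTo f T S)
    (hgS : MapsTo g T S) : ContinuousOn (fun z => ρ (f z) (g z)) T := fun z hz =>
  h.tendsto (hfS hz) (hgS hz) ((hf z hz).tendsto_nhdsWithin hfS)
    ((hg z hz).tendsto_nhdsWithin hgS)

end Metric

/-! ### Slopes -/

section Slope

variable {Y : Type*} [MetricSpace Y] {S : Set Y} {ρ : Y → Y → ℝ} {f : Y → ℝ} {x : Y} {c : ℝ}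

theorem slopeWrt_le (h : IsMetricOn S ρ) (hx : x ∈ S) (hc : 0 ≤ c)
    (hf : ∀ᶠ y in 𝓝[S \ {x}] x, |f y - f x| ≤ c * ρ x y) : slopeWrt S ρ f x ≤ c := by
  refine limsup_le_of_eventually_nonneg hc ?_ ?_
  · filter_upwards [self_mem_nhdsWithin] with y hy
    exact div_nonneg (abs_nonneg _) (h.nonneg hx hy.1)
  · filter_upwards [self_mem_nhdsWithin, hf] with y hy hfy
    exact (div_le_iff₀ (h.pos hx hy.1 fun e => hy.2 e.symm)).2 hfy

theorem lowerSlopeWrt_le (h : IsMetricOn S ρ) (hx : x ∈ S) (hc : 0 ≤ c)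
    (hf : ∀ᶠ y in 𝓝[S \ {x}] x, f x - f y ≤ c * ρ x y) : lowerSlopeWrt S ρ f x ≤ c := by
  refine limsup_le_of_eventually_nonneg hc ?_ ?_
  · filter_upwards [self_mem_nhdsWithin] with y hy
    exact div_nonneg (le_max_right _ _) (h.nonneg hx hy.1)
  · filter_upwards [self_mem_nhdsWithin, hf] with y hy hfy
    have := h.pos hx hy.1 fun e => hy.2 e.symm
    exact (div_le_iff₀ this).2 (max_le hfy (by positivity))

theorem LocLipWrt.exists_nonneg (h : IsMetricOn S ρ) (hf : LocLipWrt S ρ f) (hx : x ∈ S) :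
    ∃ K : ℝ, 0 ≤ K ∧ ∃ t ∈ 𝓝[S] x, ∀ y ∈ t ∩ S, ∀ z ∈ t ∩ S, |f y - f z| ≤ K * ρ y z := by
  obtain ⟨K, t, ht, hK⟩ := hf x hx
  refine ⟨max K 0, le_max_right _ _, t, ht, fun y hy z hz => (hK y hy z hz).trans ?_⟩
  exact mul_le_mul_of_nonneg_right (le_max_left _ _) (h.nonneg hy.2 hz.2)

theorem LocLipWrt.eventually_abs_sub_le (h : IsMetricOn S ρ) (hf : LocLipWrt S ρ f)
    (hx : x ∈ S) : ∃ K : ℝ, 0 ≤ K ∧ ∀ᶠ z in 𝓝[S] x,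
      ∀ᶠ y in 𝓝[S \ {z}] z, |f y - f z| ≤ K * ρ z y := by
  obtain ⟨K, hK0, t, ht, hK⟩ := hf.exists_nonneg h hx
  refine ⟨K, hK0, ?_⟩
  filter_upwards [eventually_eventually_nhdsWithin.2 ht, self_mem_nhdsWithin] with z hz hzS
  have hzt : z ∈ t := mem_of_mem_nhdsWithin hzS hz
  filter_upwards [nhdsWithin_mono z sdiff_subset hz, self_mem_nhdsWithin] with y hy hyS
  rw [abs_sub_comm]
  exact hK z ⟨hzt, hzS⟩ y ⟨hy, hyS.1⟩

theorem LocLipWrt.exists_eventually_slopeWrt_le (h : IsMetricOn S ρ) (hf : LocLipWrt S ρ f)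
    (hx : x ∈ S) : ∃ K : ℝ, ∀ᶠ z in 𝓝[S] x, slopeWrt S ρ f z ≤ K := by
  obtain ⟨K, hK0, hK⟩ := hf.eventually_abs_sub_le h hx
  refine ⟨K, ?_⟩
  filter_upwards [hK, self_mem_nhdsWithin] with z hz hzS using slopeWrt_le h hzS hK0 hz

theorem LocLipWrt.exists_eventually_div_le (h : IsMetricOn S ρ) (hf : LocLipWrt S ρ f)
    (hx : x ∈ S) : ∃ K : ℝ, ∀ᶠ y in 𝓝[S \ {x}] x, |f y - f x| / ρ x y ≤ K := by
  obtain ⟨K, -, hK⟩ := hf.eventually_abs_sub_le h hx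
  refine ⟨K, ?_⟩
  filter_upwards [show ∀ᶠ y in 𝓝[S \ {x}] x, |f y - f x| ≤ K * ρ x y from
    hK.self_of_nhdsWithin hx, self_mem_nhdsWithin] with y hy hyS
  exact (div_le_iff₀ (h.pos hx hyS.1 fun e => hyS.2 e.symm)).2 hy

theorem LocLipWrt.slopeWrt_nonneg (h : IsMetricOn S ρ) (hf : LocLipWrt S ρ f) (hx : x ∈ S) :
    0 ≤ slopeWrt S ρ f x := by
  obtain ⟨K, hK⟩ := hf.exists_eventually_div_le h hx
  refine limsup_nonneg_of_eventually ?_ hK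
  filter_upwards [self_mem_nhdsWithin] with y hy
  exact div_nonneg (abs_nonneg _) (h.nonneg hx hy.1)

theorem LocLipWrt.eventually_of_slopeWrt_lt (h : IsMetricOn S ρ) (hf : LocLipWrt S ρ f)
    (hx : x ∈ S) (hc : slopeWrt S ρ f x < c) :
    ∀ᶠ y in 𝓝[S \ {x}] x, |f y - f x| ≤ c * ρ x y := by
  obtain ⟨K, hK⟩ := hf.exists_eventually_div_le h hx
  filter_upwards [eventually_lt_of_limsup_lt hc (isBoundedUnder_of_eventually_le hK),
    self_mem_nhdsWithin] with y hy hyS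
  exact ((div_lt_iff₀ (h.pos hx hyS.1 fun e => hyS.2 e.symm)).1 hy).le

theorem LocLipWrt.continuousOn (h : IsMetricOn S ρ) (hf : LocLipWrt S ρ f) :
    ContinuousOn f S := by
  intro x hx
  obtain ⟨K, -, t, ht, hK⟩ := hf.exists_nonneg h hx
  have h0 := (h.tendsto_zero hx tendsto_id).const_mul K
  rw [mul_zero] at h0
  refine tendsto_iff_dist_tendsto_zero.2
    (squeeze_zero' (Eventually.of_forall fun _ => dist_nonneg) ?_ h0)
  filter_upwards [ht, self_mem_nhdsWithin] with y hy hyS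
  rw [dist_comm]
  exact hK x ⟨mem_of_mem_nhdsWithin hx ht, hx⟩ y ⟨hy, hyS⟩

/-! ### Squared distance functions -/

theorem locLipWrt_sq (h : IsMetricOn S ρ) (c : ℝ) {y : Y} (hy : y ∈ S) :
    LocLipWrt S ρ fun z => c * ρ z y ^ 2 := by
  intro x hx
  refine ⟨|c| * (2 * (ρ x y + 1)), _, (h.nhds_basis x hx).mem_of_mem one_pos, ?_⟩
  rintro z ⟨⟨-, hz⟩, hzS⟩ w ⟨⟨-, hw⟩, hwS⟩
  have e : c * ρ z y ^ 2 - c * ρ w y ^ 2 = c * ((ρ z y + ρ w y) * (ρ z y - ρ w y)) := by ring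
  have hz0 := h.nonneg hzS hy
  have hw0 := h.nonneg hwS hy
  have hz1 := h.triangle z hzS x hx y hy
  have hw1 := h.triangle w hwS x hx y hy
  have hd : |ρ z y - ρ w y| ≤ ρ z w := by
    simpa [h.refl y hy, h.symm w hwS z hzS] using h.abs_sub_le hwS hy hzS hy
  rw [h.symm z hzS x hx] at hz1
  rw [h.symm w hwS x hx] at hw1
  rw [e, abs_mul, abs_mul, mul_assoc, abs_of_nonneg (add_nonneg hz0 hw0)]
  have hs : ρ z y + ρ w y ≤ 2 * (ρ x y + 1) := by linarith
  have hs0 := (add_nonneg hz0 hw0).trans hs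
  gcongr

theorem eventually_abs_sq_sub_le (h : IsMetricOn S ρ) {y : Y} (hx : x ∈ S) (hy : y ∈ S)
    (hc : 0 ≤ c) {b : ℝ} (hb : 2 * c * ρ x y < b) :
    ∀ᶠ z in 𝓝[S \ {x}] x, |c * ρ z y ^ 2 - c * ρ x y ^ 2| ≤ b * ρ x z := by
  have hlim : Tendsto (fun z => c * (2 * ρ x y + ρ x z)) (𝓝[S \ {x}] x)
      (𝓝 (c * (2 * ρ x y + 0))) :=
    ((h.tendsto_zero hx (tendsto_id.mono_left (nhdsWithin_mono x sdiff_subset))).const_add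
      _).const_mul c
  filter_upwards [hlim.eventually_lt_const (by linarith : _ < b), self_mem_nhdsWithin]
    with z hz hzS
  have e : c * ρ z y ^ 2 - c * ρ x y ^ 2 = c * ((ρ z y + ρ x y) * (ρ z y - ρ x y)) := by ring
  have hz0 := h.nonneg hzS.1 hy
  have hx0 := h.nonneg hx hy
  have hz1 := h.triangle z hzS.1 x hx y hy
  have hd : |ρ z y - ρ x y| ≤ ρ x z := by
    simpa [h.refl y hy] using h.abs_sub_le hx hy hzS.1 hy
  rw [h.symm z hzS.1 x hx] at hz1
  rw [e, abs_mul, abs_mul, abs_of_nonneg hc, abs_of_nonneg (add_nonneg hz0 hx0), ← mul_assoc]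
  have := h.nonneg hx hzS.1
  calc c * (ρ z y + ρ x y) * |ρ z y - ρ x y| ≤ c * (2 * ρ x y + ρ x z) * ρ x z := by
        have hs : ρ z y + ρ x y ≤ 2 * ρ x y + ρ x z := by linarith
        gcongr
    _ ≤ b * ρ x z := by gcongr

theorem slopeWrt_sq_le (h : IsMetricOn S ρ) {y : Y} (hx : x ∈ S) (hy : y ∈ S) (hc : 0 ≤ c) :
    slopeWrt S ρ (fun z => c * ρ z y ^ 2) x ≤ 2 * c * ρ x y := by
  have := h.nonneg hx hy
  refine le_of_forall_gt_imp_ge_of_dense fun b hb => ?_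
  exact slopeWrt_le h hx ((by positivity : 0 ≤ 2 * c * ρ x y).trans hb.le)
    (eventually_abs_sq_sub_le h hx hy hc hb)

theorem lowerSlopeWrt_le_slopeWrt (h : IsMetricOn S ρ) (hf : LocLipWrt S ρ f) (hx : x ∈ S) :
    lowerSlopeWrt S ρ f x ≤ slopeWrt S ρ f x := by
  refine le_of_forall_gt_imp_ge_of_dense fun b hb => ?_
  refine lowerSlopeWrt_le h hx ((hf.slopeWrt_nonneg h hx).trans hb.le) ?_
  filter_upwards [hf.eventually_of_slopeWrt_lt h hx hb] with y hy
  rw [abs_sub_comm] at hy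
  exact (le_abs_self _).trans hy

theorem exists_eventually_lower_div_le (h : IsMetricOn S ρ) (hf : LocLipWrt S ρ f) (hx : x ∈ S) :
    ∃ K : ℝ, ∀ᶠ y in 𝓝[S \ {x}] x, max (f x - f y) 0 / ρ x y ≤ K := by
  obtain ⟨K, hK⟩ := hf.exists_eventually_div_le h hx
  refine ⟨K, ?_⟩
  filter_upwards [hK, self_mem_nhdsWithin] with y hy hyS
  refine le_trans ?_ hy
  have := h.pos hx hyS.1 fun e => hyS.2 e.symm
  gcongr
  rw [abs_sub_comm]
  exact max_le (le_abs_self _) (abs_nonneg _)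

theorem le_lowerSlopeWrt_sq (h : IsMetricOn S ρ) (hg : IsGeodesicWrt S ρ) {y : Y} (hx : x ∈ S)
    (hy : y ∈ S) :
    2 * c * ρ x y ≤ lowerSlopeWrt S ρ (fun z => c * ρ z y ^ 2) x := by
  obtain ⟨K, hK⟩ := exists_eventually_lower_div_le h (locLipWrt_sq h c hy) hx
  rcases eq_or_ne x y with rfl | hxy
  · rw [h.refl x hx, mul_zero]
    refine limsup_nonneg_of_eventually ?_ hK
    filter_upwards [self_mem_nhdsWithin] with z hz
    exact div_nonneg (le_max_right _ _) (h.nonneg hx hz.1)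
  obtain ⟨γ, hγ0, hγ1, hγS, hγ⟩ := hg x hx y hy
  have hr := h.pos hx hy hxy
  set r := ρ x y with hr_def
  have hIoo : Ioo 0 r ∈ 𝓝[>] (0 : ℝ) := Ioo_mem_nhdsGT hr
  have hγx : ∀ t ∈ Ioo 0 r, ρ x (γ t) = t := fun t ht => by
    have := hγ 0 ⟨le_rfl, hr.le⟩ t ⟨ht.1.le, ht.2.le⟩
    rwa [hγ0, zero_sub, abs_neg, abs_of_pos ht.1] at this
  have hγy : ∀ t ∈ Ioo 0 r, ρ (γ t) y = r - t := fun t ht => by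
    have := hγ t ⟨ht.1.le, ht.2.le⟩ r ⟨hr.le, le_rfl⟩
    rwa [hγ1, abs_sub_comm, abs_of_pos (sub_pos.2 ht.2)] at this
  have hlim : Tendsto γ (𝓝[>] 0) (𝓝[S \ {x}] x) := by
    have hmem : ∀ᶠ t in 𝓝[>] (0 : ℝ), γ t ∈ S \ {x} := by
      filter_upwards [hIoo] with t ht
      refine ⟨hγS t ⟨ht.1.le, ht.2.le⟩, fun e => ?_⟩
      have := hγx t ht
      rw [mem_singleton_iff.1 e, h.refl x hx] at this
      exact ht.1.ne this
    refine tendsto_nhdsWithin_iff.2 ⟨?_, hmem⟩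
    have : Tendsto γ (𝓝[>] 0) (𝓝[S] x) := by
      refine (h.nhds_basis x hx).tendsto_right_iff.2 fun ε hε => ?_
      filter_upwards [hIoo, Ioo_mem_nhdsGT hε] with t ht ht'
      exact ⟨hγS t ⟨ht.1.le, ht.2.le⟩, by rw [hγx t ht]; exact ht'.2⟩
    exact this.mono_right nhdsWithin_le_nhds
  refine le_of_forall_lt_imp_le_of_dense fun b hb => ?_
  refine le_limsup_of_frequently_of_eventually (hlim.frequently (Eventually.frequently ?_)) hK
  have hlim2 : Tendsto (fun t : ℝ => c * (2 * r - t)) (𝓝[>] 0) (𝓝 (c * (2 * r - 0))) :=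
    ((tendsto_id.mono_left nhdsWithin_le_nhds).const_sub _).const_mul c
  filter_upwards [hIoo, hlim2.eventually_const_lt (by linarith : b < _)] with t ht hbt
  rw [hγx t ht, hγy t ht, le_div_iff₀ ht.1]
  refine le_max_of_le_left ?_
  nlinarith [ht.1]

theorem slopeWrt_sq (h : IsMetricOn S ρ) (hg : IsGeodesicWrt S ρ) {y : Y} (hx : x ∈ S)
    (hy : y ∈ S) (hc : 0 ≤ c) : slopeWrt S ρ (fun z => c * ρ z y ^ 2) x = 2 * c * ρ x y :=
  (slopeWrt_sq_le h hx hy hc).antisymm ((le_lowerSlopeWrt_sq h hg hx hy).trans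
    (lowerSlopeWrt_le_slopeWrt h (locLipWrt_sq h c hy) hx))

theorem continuousOn_slopeWrt_sq (h : IsMetricOn S ρ) (hg : IsGeodesicWrt S ρ) {y : Y}
    (hy : y ∈ S) (hc : 0 ≤ c) : ContinuousOn (slopeWrt S ρ fun z => c * ρ z y ^ 2) S :=
  ContinuousOn.congr (continuousOn_const.mul (h.continuousOn continuousOn_id continuousOn_const
    (mapsTo_id S) fun _ _ => hy)) fun _ hx => slopeWrt_sq h hg hx hy hc

theorem isC1MinusWrt_sq (h : IsMetricOn S ρ) (hg : IsGeodesicWrt S ρ) {y : Y}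
    (hy : y ∈ S) (hc : 0 ≤ c) : IsC1MinusWrt S ρ fun z => c * ρ z y ^ 2 :=
  ⟨locLipWrt_sq h c hy, continuousOn_slopeWrt_sq h hg hy hc, fun _ hx =>
    (lowerSlopeWrt_le_slopeWrt h (locLipWrt_sq h c hy) hx).antisymm
      ((slopeWrt_sq_le h hx hy hc).trans (le_lowerSlopeWrt_sq h hg hx hy))⟩

end Slope

/-! ### Testing with squared distance functions suffices -/

section Doubling

variable {Y : Type*} [MetricSpace Y] {S : Set Y} {ρ : Y → Y → ℝ}

theorem lowerSlopeWrt_le_of_isLocalMinOn (h : IsMetricOn S ρ) {f g : Y → ℝ} {y : Y} {b : ℝ}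
    (hy : y ∈ S) (hb : 0 ≤ b) (hmin : IsLocalMinOn (fun z => f z + g z) S y)
    (hg : ∀ᶠ z in 𝓝[S \ {y}] y, |g z - g y| ≤ b * ρ y z) : lowerSlopeWrt S ρ f y ≤ b := by
  refine lowerSlopeWrt_le h hy hb ?_
  have hmin' : ∀ᶠ z in 𝓝[S \ {y}] y, f y + g y ≤ f z + g z :=
    nhdsWithin_mono y sdiff_subset hmin
  filter_upwards [hmin', hg] with z hz hgz
  linarith [(abs_le.1 hgz).2]

theorem abs_sub_slopeWrt_le_of_isLocalMinOn (h : IsMetricOn S ρ) (hgeo : IsGeodesicWrt S ρ)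
    {ψ₁ ψ₂ : Y → ℝ} (hψ₁ : IsC1MinusWrt S ρ ψ₁) (hψ₂ : LocLipWrt S ρ ψ₂) {x x' y : Y}
    (hx : x ∈ S) (hx' : x' ∈ S) (hy : y ∈ S) {k : ℝ} (hk : 0 ≤ k)
    (hmin : IsLocalMinOn (fun z => ψ₁ z + ψ₂ z + 1 * ρ z x ^ 2 + k * ρ z x' ^ 2) S y) :
    |2 * k * ρ y x' - slopeWrt S ρ ψ₁ y| ≤ slopeWrt S ρ ψ₂ y + 2 * ρ y x := by
  have h1 := hψ₁.1.slopeWrt_nonneg h hy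
  have h2 := hψ₂.slopeWrt_nonneg h hy
  have h3 := h.nonneg hy hx
  have h4 : 0 ≤ 2 * k * ρ y x' := mul_nonneg (by positivity) (h.nonneg hy hx')
  refine le_of_forall_pos_le_add fun ε hε => ?_
  have e1 := hψ₁.1.eventually_of_slopeWrt_lt h hy (c := slopeWrt S ρ ψ₁ y + ε / 3) (by linarith)
  have e2 := hψ₂.eventually_of_slopeWrt_lt h hy (c := slopeWrt S ρ ψ₂ y + ε / 3) (by linarith)
  have e3 := eventually_abs_sq_sub_le h hy hx zero_le_one (b := 2 * ρ y x + ε / 3) (by linarith)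
  have e4 := eventually_abs_sq_sub_le h hy hx' hk (b := 2 * k * ρ y x' + ε / 3) (by linarith)
  rw [abs_le]
  constructor
  · have := lowerSlopeWrt_le_of_isLocalMinOn h (f := ψ₁)
      (g := fun z => ψ₂ z + 1 * ρ z x ^ 2 + k * ρ z x' ^ 2) hy
      (b := slopeWrt S ρ ψ₂ y + 2 * ρ y x + 2 * k * ρ y x' + ε) (by positivity)
      (by simpa only [add_assoc] using hmin) (by
        filter_upwards [e2, e3, e4] with z h2 h3 h4
        rw [abs_le] at h2 h3 h4 ⊢
        constructor <;> linarith [h2.1, h2.2, h3.1, h3.2, h4.1, h4.2])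
    rw [hψ₁.2.2 y hy] at this
    linarith
  · have := lowerSlopeWrt_le_of_isLocalMinOn h (f := fun z => k * ρ z x' ^ 2)
      (g := fun z => ψ₁ z + ψ₂ z + 1 * ρ z x ^ 2) hy
      (b := slopeWrt S ρ ψ₁ y + slopeWrt S ρ ψ₂ y + 2 * ρ y x + ε) (by positivity)
      (by simpa only [add_comm] using hmin) (by
        filter_upwards [e1, e2, e3] with z h2 h3 h4
        rw [abs_le] at h2 h3 h4 ⊢
        constructor <;> linarith [h2.1, h2.2, h3.1, h3.2, h4.1, h4.2])
    linarith [le_lowerSlopeWrt_sq h hgeo (c := k) hy hx']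

theorem Hlow_le_of_quadratic_tests (hS : IsCompact S) (h : IsMetricOn S ρ)
    (hgeo : IsGeodesicWrt S ρ) {H : Y → ℝ → ℝ → ℝ}
    (hH : ContinuousOn (fun q : Y × ℝ × ℝ => H q.1 q.2.1 q.2.2)
      (S ×ˢ (univ : Set ℝ) ×ˢ Ici (0 : ℝ)))
    {U : Y → ℝ} {C : ℝ} (hUC : ∀ y ∈ S, |U y| ≤ C) (hU : UpperSemicontinuousOn U S)
    (hQ : ∀ k : ℝ, 0 ≤ k → ∀ x ∈ S, ∀ y ∈ S, IsLocalMaxOn (fun z => U z - k * ρ z y ^ 2) S x →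
      H x (U x) (2 * k * ρ x y) ≤ 0)
    {ψ₁ ψ₂ : Y → ℝ} (hψ₁ : IsC1MinusWrt S ρ ψ₁) (hψ₂ : LocLipWrt S ρ ψ₂) {x : Y} (hx : x ∈ S)
    (hmax : IsLocalMaxOn (fun y => U y - (ψ₁ y + ψ₂ y)) S x) :
    Hlow H (uscWrt S (slopeWrt S ρ ψ₂) x) x (U x) (slopeWrt S ρ ψ₁ x) ≤ 0 := by
  obtain ⟨R, hR, hmaxR⟩ : ∃ R > 0, ∀ y ∈ S, dist y x ≤ R →
      U y - (ψ₁ y + ψ₂ y) ≤ U x - (ψ₁ x + ψ₂ x) := by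
    obtain ⟨ε, hε, hb⟩ := Metric.mem_nhdsWithin_iff.1 hmax
    refine ⟨ε / 2, by positivity, fun y hy hd => hb ⟨?_, hy⟩⟩
    exact mem_ball.2 (by linarith)
  set m := U x - (ψ₁ x + ψ₂ x) with hm
  set K := S ∩ closedBall x R with hK
  have hKc : IsCompact K := hS.inter_right isClosed_closedBall
  have hKS : K ⊆ S := inter_subset_left
  have hxK : x ∈ K := ⟨hx, mem_closedBall_self hR.le⟩
  have hψ : ContinuousOn (fun y => ψ₁ y + ψ₂ y) S :=
    (hψ₁.1.continuousOn h).add (hψ₂.continuousOn h)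
  have hρx : ContinuousOn (fun y => 1 * ρ y x ^ 2) S :=
    continuousOn_const.mul ((h.continuousOn continuousOn_id continuousOn_const
      (mapsTo_id S) fun _ _ => hx).pow 2)
  have hex : ∀ n : ℕ, ∃ z ∈ K ×ˢ K, IsMaxOn (fun z : Y × Y =>
      U z.1 + -(ψ₁ z.2 + ψ₂ z.2 + 1 * ρ z.2 x ^ 2 + n * ρ z.1 z.2 ^ 2)) (K ×ˢ K) z := by
    intro n
    refine UpperSemicontinuousOn.exists_isMaxOn ⟨(x, x), hxK, hxK⟩ (hKc.prod hKc) ?_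
    have h1 : UpperSemicontinuousOn (fun z : Y × Y => U z.1) (K ×ˢ K) :=
      hU.comp continuousOn_fst fun z hz => hKS hz.1
    have h2 : ContinuousOn (fun z : Y × Y => ρ z.1 z.2) (K ×ˢ K) :=
      h.continuousOn continuousOn_fst continuousOn_snd (fun z hz => hKS hz.1)
        fun z hz => hKS hz.2
    have h3 : ContinuousOn (fun z : Y × Y => ψ₁ z.2 + ψ₂ z.2 + 1 * ρ z.2 x ^ 2) (K ×ˢ K) :=
      (hψ.add hρx).comp continuousOn_snd fun z hz => hKS hz.2
    exact h1.add (h3.add (continuousOn_const.mul (h2.pow 2))).neg.upperSemicontinuousOn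
  choose z hzK hz using hex
  obtain ⟨⟨x', y'⟩, hxy', σ, hσ, hlim⟩ := (hKc.prod hKc).tendsto_subseq hzK
  set a : ℕ → Y := fun n => (z (σ n)).1 with ha
  set b : ℕ → Y := fun n => (z (σ n)).2 with hb
  have haK : ∀ n, a n ∈ K := fun n => (hzK (σ n)).1
  have hbK : ∀ n, b n ∈ K := fun n => (hzK (σ n)).2
  have hval : ∀ n, m ≤ U (a n) - (ψ₁ (b n) + ψ₂ (b n) + 1 * ρ (b n) x ^ 2 +
      (σ n : ℝ) * ρ (a n) (b n) ^ 2) := fun n => by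
    have := hz (σ n) (show (x, x) ∈ K ×ˢ K from ⟨hxK, hxK⟩)
    simp only [h.refl x hx, mem_ofPred_eq] at this
    simp only [ha, hb]
    linarith
  have halim : Tendsto a atTop (𝓝 x') := (continuous_fst.tendsto _).comp hlim
  have hblim : Tendsto b atTop (𝓝 y') := (continuous_snd.tendsto _).comp hlim
  obtain ⟨M, hM⟩ : ∃ M, ∀ y ∈ K, |ψ₁ y + ψ₂ y| ≤ M := by
    obtain ⟨M, hM⟩ := hKc.exists_bound_of_continuousOn (hψ.mono hKS)
    exact ⟨M, hM⟩
  have hxy : x' = y' := by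
    have hσ' : Tendsto (fun n => (C + M - m) / (σ n : ℝ)) atTop (𝓝 0) :=
      tendsto_const_nhds.div_atTop (tendsto_natCast_atTop_atTop.comp hσ.tendsto_atTop)
    have hd : Tendsto (fun n => dist (a n) (b n) ^ 2) atTop (𝓝 (dist x' y' ^ 2)) :=
      (halim.dist hblim).pow 2
    have : dist x' y' ^ 2 ≤ 0 := by
      refine le_of_tendsto_of_tendsto hd hσ' ?_
      filter_upwards [hσ.tendsto_atTop.eventually_gt_atTop 0] with n hn
      have hn' : (0 : ℝ) < σ n := by exact_mod_cast hn
      have h1 := hval n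
      have h2 := (abs_le.1 (hUC _ (hKS (haK n)))).2
      have h3 := (abs_le.1 (hM _ (hbK n))).1
      have h4 := h.ge_dist _ (hKS (haK n)) _ (hKS (hbK n))
      rw [le_div_iff₀ hn']
      have h5 : dist (a n) (b n) ^ 2 ≤ ρ (a n) (b n) ^ 2 := by gcongr
      have h6 := mul_le_mul_of_nonneg_right h5 hn'.le
      linarith [sq_nonneg (ρ (b n) x)]
    exact dist_eq_zero.1 (pow_eq_zero_iff two_ne_zero |>.1 (this.antisymm (sq_nonneg _)))
  subst hxy
  have hx'S : x' ∈ S := hKS hxy'.1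
  have haS : Tendsto a atTop (𝓝[S] x') :=
    tendsto_nhdsWithin_iff.2 ⟨halim, Eventually.of_forall fun n => hKS (haK n)⟩
  have hbS : Tendsto b atTop (𝓝[S] x') :=
    tendsto_nhdsWithin_iff.2 ⟨hblim, Eventually.of_forall fun n => hKS (hbK n)⟩
  have hval' : ∀ n, m + (ψ₁ (b n) + ψ₂ (b n) + 1 * ρ (b n) x ^ 2) ≤ U (a n) := fun n => by
    have := mul_nonneg (Nat.cast_nonneg (α := ℝ) (σ n)) (sq_nonneg (ρ (a n) (b n)))
    linarith [hval n]
  have hφlim : Tendsto (fun n => m + (ψ₁ (b n) + ψ₂ (b n) + 1 * ρ (b n) x ^ 2)) atTop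
      (𝓝 (m + (ψ₁ x' + ψ₂ x' + 1 * ρ x' x ^ 2))) :=
    (((hψ.add hρx) x' hx'S).tendsto.comp hbS).const_add m
  have hle : m + (ψ₁ x' + ψ₂ x' + 1 * ρ x' x ^ 2) ≤ U x' := by
    refine le_of_forall_gt_imp_ge_of_dense fun c hc => ?_
    refine le_of_tendsto hφlim ?_
    filter_upwards [haS.eventually (hU x' hx'S c hc)] with n hn using (hval' n).trans hn.le
  obtain rfl : x' = x := by
    by_contra hne
    have := pow_pos (h.pos hx'S hx hne) 2
    linarith [hmaxR x' hx'S hxy'.1.2]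
  have hUlim : Tendsto (fun n => U (a n)) atTop (𝓝 (U x')) := by
    refine tendsto_order.2 ⟨fun c hc => ?_, fun c hc => haS.eventually (hU x' hx'S c hc)⟩
    rw [h.refl x' hx] at hφlim
    filter_upwards [hφlim.eventually_const_lt (by rw [hm]; linarith : c < _)] with n hn
    rw [h.refl x' hx] at hle
    exact hn.trans_le (hval' n)
  set q : ℕ → ℝ := fun n => 2 * (σ n : ℝ) * ρ (a n) (b n) with hq
  have hq0 : ∀ n, 0 ≤ q n := fun n =>
    mul_nonneg (by positivity) (h.nonneg (hKS (haK n)) (hKS (hbK n)))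
  have hnear : ∀ w ∈ S, dist w x' < R → ∀ᶠ v in 𝓝[S] w, v ∈ K := fun w hw hd => by
    filter_upwards [self_mem_nhdsWithin,
      nhdsWithin_le_nhds (isOpen_ball.mem_nhds (mem_ball.2 hd))] with v hv hv'
    exact ⟨hv, ball_subset_closedBall hv'⟩
  have hHq : ∀ᶠ n in atTop, H (a n) (U (a n)) (q n) ≤ 0 := by
    filter_upwards [halim.eventually (isOpen_ball.mem_nhds (mem_ball_self hR))] with n hn
    refine hQ (σ n) (Nat.cast_nonneg _) _ (hKS (haK n)) _ (hKS (hbK n)) ?_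
    filter_upwards [hnear _ (hKS (haK n)) hn] with v hv
    have := hz (σ n) (show (v, b n) ∈ K ×ˢ K from ⟨hv, hbK n⟩)
    simp only [mem_ofPred_eq] at this
    simp only [ha, hb] at this ⊢
    linarith
  have hqs : ∀ᶠ n in atTop, |q n - slopeWrt S ρ ψ₁ (b n)| ≤
      slopeWrt S ρ ψ₂ (b n) + 2 * ρ (b n) x' := by
    filter_upwards [hblim.eventually (isOpen_ball.mem_nhds (mem_ball_self hR))] with n hn
    have hs := h.symm _ (hKS (haK n)) _ (hKS (hbK n))
    simp only [hq, hs]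
    refine abs_sub_slopeWrt_le_of_isLocalMinOn h hgeo hψ₁ hψ₂ hx (hKS (haK n)) (hKS (hbK n))
      (Nat.cast_nonneg _) ?_
    filter_upwards [hnear _ (hKS (hbK n)) hn] with v hv
    have := hz (σ n) (show (a n, v) ∈ K ×ˢ K from ⟨haK n, hv⟩)
    simp only [mem_ofPred_eq] at this
    rw [← hs, h.symm v (hKS hv) _ (hKS (haK n))]
    simp only [ha, hb] at this ⊢
    linarith
  have hs1 : Tendsto (fun n => slopeWrt S ρ ψ₁ (b n)) atTop (𝓝 (slopeWrt S ρ ψ₁ x')) :=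
    (hψ₁.2.1 x' hx).tendsto.comp hbS
  have hs2 : ∀ c, uscWrt S (slopeWrt S ρ ψ₂) x' < c → ∀ᶠ n in atTop,
      slopeWrt S ρ ψ₂ (b n) < c := fun c hc => by
    obtain ⟨L, hL⟩ := hψ₂.exists_eventually_slopeWrt_le h hx
    exact hbS.eventually (eventually_lt_of_limsup_lt hc (isBoundedUnder_of_eventually_le hL))
  have hs3 : Tendsto (fun n => ρ (b n) x') atTop (𝓝 0) := by
    have := h.tendsto hx hx hbS (tendsto_const_nhdsWithin hx)
    rwa [h.refl x' hx] at this
  set A := uscWrt S (slopeWrt S ρ ψ₂) x' with hA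
  set p := slopeWrt S ρ ψ₁ x' with hp
  have hqε : ∀ ε > 0, ∀ᶠ n in atTop, |q n - p| ≤ A + ε := fun ε hε => by
    have hε3 : 0 < ε / 4 := by positivity
    filter_upwards [hqs, hs2 (A + ε / 4) (by linarith),
      hs3.eventually_lt_const hε3, hs1.eventually_lt_const (by linarith : p < p + ε / 4),
      hs1.eventually_const_lt (by linarith : p - ε / 4 < p)] with n h1 h2 h3 h4 h5
    rw [abs_le] at h1 ⊢
    constructor <;> linarith [h1.1, h1.2]
  obtain ⟨q', hq', τ, hτ, hqlim⟩ := isCompact_Icc.tendsto_subseq' (x := q)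
    (s := Icc 0 (p + A + 1)) (Eventually.frequently (by
      filter_upwards [hqε 1 one_pos] with n hn
      exact ⟨hq0 n, by linarith [(abs_le.1 hn).2]⟩))
  have hq'A : |q' - p| ≤ A := by
    refine le_of_forall_pos_le_add fun ε hε => ?_
    exact le_of_tendsto (hqlim.sub_const p).abs (hτ.tendsto_atTop.eventually (hqε ε hε))
  have hHle : H x' (U x') q' ≤ 0 := by
    have hT : Tendsto (fun n => (a (τ n), U (a (τ n)), q (τ n))) atTop
        (𝓝[S ×ˢ (univ : Set ℝ) ×ˢ Ici (0 : ℝ)] (x', U x', q')) := by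
      refine tendsto_nhdsWithin_iff.2 ⟨?_, Eventually.of_forall fun n =>
        ⟨hKS (haK _), mem_univ _, hq0 _⟩⟩
      exact (halim.comp hτ.tendsto_atTop).prodMk_nhds
        ((hUlim.comp hτ.tendsto_atTop).prodMk_nhds hqlim)
    exact le_of_tendsto ((hH (x', U x', q') ⟨hx, mem_univ _, hq'.1⟩).tendsto.comp hT)
      (hτ.tendsto_atTop.eventually hHq)
  refine (csInf_le ?_ (mem_image_of_mem (H x' (U x'))
    (show q' ∈ {q | 0 ≤ q ∧ |q - p| ≤ A} from ⟨hq'.1, hq'A⟩))).trans hHle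
  have hcont : ContinuousOn (H x' (U x')) (Icc 0 (p + A)) :=
    hH.comp (f := fun r : ℝ => (x', U x', r)) (by fun_prop)
      fun r hr => ⟨hx, mem_univ _, hr.1⟩
  refine (isCompact_Icc.image_of_continuousOn hcont).bddBelow.mono (image_mono ?_)
  intro r hr
  exact ⟨hr.1, by linarith [(abs_le.1 hr.2).2]⟩

end Doubling

/-! ### Stability under convergence of the spaces -/

section Stability

/-- Convergence along all sequences `zn n ∈ A n` tending to `z₀` passes to subsequences. -/
theorem tendsto_subseq_of_forall_seq {Z β : Type*} [TopologicalSpace Z] {A : ℕ → Set Z} {z₀ : Z}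
    {e : ℕ → Z} (he : ∀ n, e n ∈ A n) (he_lim : Tendsto e atTop (𝓝 z₀)) {F : ℕ → Z → β}
    {l : Filter β} [l.IsCountablyGenerated]
    (hF : ∀ zn : ℕ → Z, (∀ n, zn n ∈ A n) → Tendsto zn atTop (𝓝 z₀) →
      Tendsto (fun n => F n (zn n)) atTop l)
    {φ : ℕ → ℕ} (hφ : Tendsto φ atTop atTop) {z : ℕ → Z} (hz : ∀ k, z k ∈ A (φ k))
    (hz_lim : Tendsto z atTop (𝓝 z₀)) : Tendsto (fun k => F (φ k) (z k)) atTop l := by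
  refine tendsto_of_subseq_tendsto fun ns hns => ?_
  obtain ⟨ms, hms, hmono⟩ := strictMono_subseq_of_tendsto_atTop (hφ.comp hns)
  refine ⟨ms, ?_⟩
  set θ : ℕ → ℕ := (φ ∘ ns) ∘ ms with hθ
  set z' : ℕ → Z := Function.extend θ (fun k => z (ns (ms k))) e with hz'
  have hval : ∀ k, z' (θ k) = z (ns (ms k)) := fun k => hmono.injective.extend_apply _ _ k
  have hmem : ∀ n, z' n ∈ A n := fun n => by
    by_cases h : ∃ k, θ k = n
    · obtain ⟨k, rfl⟩ := h
      rw [hval]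
      exact hz _
    · rw [hz', Function.extend_apply' _ _ _ h]
      exact he n
  have hlim : Tendsto z' atTop (𝓝 z₀) := by
    refine tendsto_def.2 fun V hV => ?_
    obtain ⟨K, hK⟩ := eventually_atTop.1 ((hz_lim.comp (hns.comp hms.tendsto_atTop)).eventually hV)
    filter_upwards [he_lim.eventually hV, eventually_ge_atTop (θ K)] with n hn hKn
    by_cases h : ∃ k, θ k = n
    · obtain ⟨k, rfl⟩ := h
      rw [mem_preimage, hval]
      exact hK k (hmono.le_iff_le.1 hKn)
    · rw [mem_preimage, hz', Function.extend_apply' _ _ _ h]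
      exact hn
  refine ((hF z' hmem hlim).comp hmono.tendsto_atTop).congr fun k => ?_
  simp only [Function.comp_apply, hval]
  rfl

theorem exists_eq_Hlow {Y : Type*} [TopologicalSpace Y] {S : Set Y} {H : Y → ℝ → ℝ → ℝ}
    (hH : ContinuousOn (fun q : Y × ℝ × ℝ => H q.1 q.2.1 q.2.2)
      (S ×ˢ (univ : Set ℝ) ×ˢ Ici (0 : ℝ)))
    {x : Y} (hx : x ∈ S) {a r p : ℝ} (ha : 0 ≤ a) (hp : 0 ≤ p) :
    ∃ q, 0 ≤ q ∧ |q - p| ≤ a ∧ H x r q = Hlow H a x r p := by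
  have hset : {q : ℝ | 0 ≤ q ∧ |q - p| ≤ a} = Ici 0 ∩ closedBall p a := by
    ext q
    simp [Real.dist_eq]
  have hc : IsCompact {q : ℝ | 0 ≤ q ∧ |q - p| ≤ a} := by
    rw [hset]
    exact (isCompact_closedBall p a).inter_left isClosed_Ici
  have hcont : ContinuousOn (H x r) {q : ℝ | 0 ≤ q ∧ |q - p| ≤ a} :=
    hH.comp (f := fun q : ℝ => (x, r, q)) (by fun_prop) fun q hq => ⟨hx, mem_univ _, hq.1⟩
  have hne : {q : ℝ | 0 ≤ q ∧ |q - p| ≤ a}.Nonempty := ⟨p, hp, by simpa using ha⟩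
  obtain ⟨q, hq, hqe⟩ := (hc.image_of_continuousOn hcont).sInf_mem (hne.image _)
  exact ⟨q, hq.1, hq.2, hqe⟩

theorem abs_limsup_le {Y : Type*} {X : ℕ → Set Y} {u : ℕ → Y → ℝ} {C : ℝ} {xn : ℕ → Y}
    (hbdd : ∀ n, ∀ x ∈ X n, |u n x| ≤ C)
    (hxn : ∀ n, xn n ∈ X n) :
    |limsup (fun n => u n (xn n)) atTop| ≤ C := by
  have h := fun n => abs_le.1 (hbdd n _ (hxn n))
  rw [abs_le]
  exact ⟨le_limsup_of_frequently_of_eventually (Frequently.of_forall fun n => (h n).1)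
    (Eventually.of_forall fun n => (h n).2), limsup_le_of_le
    (isCoboundedUnder_le_of_eventually_le _ (Eventually.of_forall fun n => (h n).1))
    (Eventually.of_forall fun n => (h n).2)⟩

variable {Y : Type*} [MetricSpace Y] {X : ℕ → Set Y} {Xi : Set Y}

theorem exists_seq_tendsto_of_hausdorffDist (hXne : ∀ n, (X n).Nonempty)
    (hXc : ∀ n, IsCompact (X n)) (hXic : IsCompact Xi)
    (h1 : Tendsto (fun n => hausdorffDist (X n) Xi) atTop (𝓝 0)) {x : Y} (hx : x ∈ Xi) :
    ∃ e : ℕ → Y, (∀ n, e n ∈ X n) ∧ Tendsto e atTop (𝓝 x) := by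
  choose e he hdist using fun n => (hXc n).exists_infDist_eq_dist (hXne n) x
  refine ⟨e, he, tendsto_iff_dist_tendsto_zero.2 (squeeze_zero (fun _ => dist_nonneg)
    (fun n => ?_) h1)⟩
  rw [dist_comm, ← hdist, hausdorffDist_comm]
  exact infDist_le_hausdorffDist_of_mem hx
    (hausdorffEDist_ne_top_of_nonempty_of_bounded ⟨x, hx⟩ (hXne n) hXic.isBounded
      (hXc n).isBounded)

theorem exists_subseq_tendsto_of_hausdorffDist (hXc : ∀ n, IsCompact (X n))
    (hXine : Xi.Nonempty) (hXic : IsCompact Xi)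
    (h1 : Tendsto (fun n => hausdorffDist (X n) Xi) atTop (𝓝 0)) {φ : ℕ → ℕ}
    (hφ : Tendsto φ atTop atTop) {a : ℕ → Y} (ha : ∀ k, a k ∈ X (φ k)) :
    ∃ x ∈ Xi, ∃ σ : ℕ → ℕ, StrictMono σ ∧ Tendsto (a ∘ σ) atTop (𝓝 x) := by
  choose b hb hdist using fun k => hXic.exists_infDist_eq_dist hXine (a k)
  obtain ⟨x, hx, σ, hσ, hlim⟩ := hXic.tendsto_subseq hb
  refine ⟨x, hx, σ, hσ, ?_⟩
  have h0 : Tendsto (fun k => dist (b k) (a k)) atTop (𝓝 0) := by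
    refine squeeze_zero (fun _ => dist_nonneg) (fun k => ?_) (h1.comp hφ)
    rw [dist_comm, ← hdist]
    exact infDist_le_hausdorffDist_of_mem (ha k)
      (hausdorffEDist_ne_top_of_nonempty_of_bounded ⟨_, ha k⟩ hXine (hXc _).isBounded
        hXic.isBounded)
  exact (tendsto_iff_of_dist (h0.comp hσ.tendsto_atTop)).1 hlim

theorem le_zero_of_quadratic_test {d : ℕ → Y → Y → ℝ} {di : Y → Y → ℝ}
    {H : ℕ → Y → ℝ → ℝ → ℝ} {Hi : Y → ℝ → ℝ → ℝ} {u : ℕ → Y → ℝ} {U : Y → ℝ} {C : ℝ}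
    (hXc : ∀ n, IsCompact (X n)) (hXine : Xi.Nonempty) (hXic : IsCompact Xi)
    (hmet : ∀ n, IsMetricOn (X n) (d n)) (hgeo : ∀ n, IsGeodesicWrt (X n) (d n))
    (hmeti : IsMetricOn Xi di)
    (hHc : ∀ n, ContinuousOn (fun q : Y × ℝ × ℝ => H n q.1 q.2.1 q.2.2)
      (X n ×ˢ (univ : Set ℝ) ×ˢ Ici (0 : ℝ)))
    (h1 : Tendsto (fun n => hausdorffDist (X n) Xi) atTop (𝓝 0))
    (happ : ∀ x ∈ Xi, ∃ e : ℕ → Y, (∀ n, e n ∈ X n) ∧ Tendsto e atTop (𝓝 x))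
    (h2 : ∀ φ : ℕ → ℕ, Tendsto φ atTop atTop → ∀ a ∈ Xi, ∀ b ∈ Xi, ∀ an bn : ℕ → Y,
      (∀ k, an k ∈ X (φ k)) → (∀ k, bn k ∈ X (φ k)) →
      Tendsto an atTop (𝓝 a) → Tendsto bn atTop (𝓝 b) →
      Tendsto (fun k => d (φ k) (an k) (bn k)) atTop (𝓝 (di a b)))
    (h3 : ∀ φ : ℕ → ℕ, Tendsto φ atTop atTop → ∀ x ∈ Xi, ∀ xn : ℕ → Y, (∀ k, xn k ∈ X (φ k)) →
      Tendsto xn atTop (𝓝 x) → ∀ r p : ℝ, 0 ≤ p → ∀ rn pn : ℕ → ℝ, (∀ k, 0 ≤ pn k) →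
      Tendsto rn atTop (𝓝 r) → Tendsto pn atTop (𝓝 p) →
      Tendsto (fun k => H (φ k) (xn k) (rn k) (pn k)) atTop (𝓝 (Hi x r p)))
    (hsub : ∀ n, IsMVSubsolutionWrt (X n) (d n) (H n) (u n))
    (hbdd : ∀ n, ∀ x ∈ X n, |u n x| ≤ C)
    (hupper : ∀ φ : ℕ → ℕ, Tendsto φ atTop atTop → ∀ x ∈ Xi, ∀ xn : ℕ → Y,
      (∀ k, xn k ∈ X (φ k)) → Tendsto xn atTop (𝓝 x) → ∀ c, U x < c →
      ∀ᶠ k in atTop, uscWrt (X (φ k)) (u (φ k)) (xn k) < c)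
    (hlower : ∀ x ∈ Xi, ∀ R > 0, ∃ φ : ℕ → ℕ, Tendsto φ atTop atTop ∧ ∃ zn : ℕ → Y,
      (∀ k, zn k ∈ X (φ k)) ∧ (∀ k, dist (zn k) x ≤ R) ∧ Tendsto zn atTop (𝓝 x) ∧
      ∀ c < U x, ∀ᶠ k in atTop, c < uscWrt (X (φ k)) (u (φ k)) (zn k))
    {c : ℝ} (hc : 0 ≤ c) {x y : Y} (hx : x ∈ Xi) (hy : y ∈ Xi)
    (hmax : IsLocalMaxOn (fun z => U z - c * di z y ^ 2) Xi x) :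
    Hi x (U x) (2 * c * di x y) ≤ 0 := by
  obtain ⟨R, hR, hmaxR⟩ : ∃ R > 0, ∀ z ∈ Xi, dist z x ≤ R →
      U z - c * di z y ^ 2 ≤ U x - c * di x y ^ 2 := by
    obtain ⟨ε, hε, hb⟩ := Metric.mem_nhdsWithin_iff.1 hmax
    refine ⟨ε / 2, by positivity, fun z hz hd => hb ⟨?_, hz⟩⟩
    exact mem_ball.2 (by linarith)
  obtain ⟨e, heX, he⟩ := happ x hx
  obtain ⟨f, hfX, hf⟩ := happ y hy
  obtain ⟨φ, hφ, zn, hznX, hznR, hzn, hzU⟩ := hlower x hx R hR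
  set w : ℕ → Y → ℝ := fun n => uscWrt (X n) (u n) with hw
  set g : ℕ → Y → ℝ := fun n v => c * d n v (f n) ^ 2 + 1 * d n v (e n) ^ 2 with hg
  have hex : ∀ k, ∃ a ∈ X (φ k) ∩ closedBall x R,
      IsMaxOn (fun v => w (φ k) v + -g (φ k) v) (X (φ k) ∩ closedBall x R) a := by
    intro k
    refine UpperSemicontinuousOn.exists_isMaxOn ⟨zn k, hznX k, hznR k⟩
      ((hXc _).inter_right isClosed_closedBall) ?_
    have hd : ∀ v ∈ X (φ k), ContinuousOn (fun z => d (φ k) z v) (X (φ k)) := fun v hv =>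
      (hmet _).continuousOn continuousOn_id continuousOn_const (mapsTo_id _) fun _ _ => hv
    have hgc : ContinuousOn (g (φ k)) (X (φ k)) :=
      (continuousOn_const.mul ((hd _ (hfX _)).pow 2)).add
        (continuousOn_const.mul ((hd _ (heX _)).pow 2))
    exact ((upperSemicontinuousOn_uscWrt (hbdd _)).add
      hgc.neg.upperSemicontinuousOn).mono inter_subset_left
  choose a' ha' hamax' using hex
  obtain ⟨x', hx', σ, hσ, hlim⟩ :=
    exists_subseq_tendsto_of_hausdorffDist hXc hXine hXic h1 hφ fun k => (ha' k).1
  set θ : ℕ → ℕ := φ ∘ σ with hθ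
  have hθlim : Tendsto θ atTop atTop := hφ.comp hσ.tendsto_atTop
  set a : ℕ → Y := a' ∘ σ with ha_def
  have ha : ∀ k, a k ∈ X (θ k) ∩ closedBall x R := fun k => ha' (σ k)
  have hamax : ∀ k, ∀ v ∈ X (θ k) ∩ closedBall x R,
      w (θ k) v - g (θ k) v ≤ w (θ k) (a k) - g (θ k) (a k) := fun k v hv => by
    have h := hamax' (σ k) hv
    simp only [mem_ofPred_eq, ← sub_eq_add_neg] at h
    exact h
  have haf : Tendsto (fun k => d (θ k) (a k) (f (θ k))) atTop (𝓝 (di x' y)) :=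
    h2 θ hθlim x' hx' y hy a _ (fun k => (ha k).1) (fun k => hfX _) hlim (hf.comp hθlim)
  have hae : Tendsto (fun k => d (θ k) (a k) (e (θ k))) atTop (𝓝 (di x' x)) :=
    h2 θ hθlim x' hx' x hx a _ (fun k => (ha k).1) (fun k => heX _) hlim (he.comp hθlim)
  have hzlim : Tendsto (zn ∘ σ) atTop (𝓝 x) := hzn.comp hσ.tendsto_atTop
  have hzf : Tendsto (fun k => d (θ k) ((zn ∘ σ) k) (f (θ k))) atTop (𝓝 (di x y)) :=
    h2 θ hθlim x hx y hy _ _ (fun k => hznX _) (fun k => hfX _) hzlim (hf.comp hθlim)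
  have hze : Tendsto (fun k => d (θ k) ((zn ∘ σ) k) (e (θ k))) atTop (𝓝 0) := by
    rw [← hmeti.refl x hx]
    exact h2 θ hθlim x hx x hx _ _ (fun k => hznX _) (fun k => heX _) hzlim (he.comp hθlim)
  have hga : Tendsto (fun k => g (θ k) (a k)) atTop
      (𝓝 (c * di x' y ^ 2 + 1 * di x' x ^ 2)) :=
    ((haf.pow 2).const_mul c).add ((hae.pow 2).const_mul 1)
  have hgz : Tendsto (fun k => g (θ k) ((zn ∘ σ) k)) atTop
      (𝓝 (c * di x y ^ 2 + 1 * 0 ^ 2)) :=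
    ((hzf.pow 2).const_mul c).add ((hze.pow 2).const_mul 1)
  have hdiff := hga.sub hgz
  have hwlow : ∀ b, b < U x + ((c * di x' y ^ 2 + 1 * di x' x ^ 2) -
      (c * di x y ^ 2 + 1 * 0 ^ 2)) → ∀ᶠ k in atTop, b < w (θ k) (a k) := fun b hb => by
    obtain ⟨ε, hε, hbε⟩ : ∃ ε > 0, b + 2 * ε = U x + ((c * di x' y ^ 2 + 1 * di x' x ^ 2) -
      (c * di x y ^ 2 + 1 * 0 ^ 2)) := ⟨_, half_pos (sub_pos.2 hb), by ring⟩
    filter_upwards [hσ.tendsto_atTop.eventually (hzU (U x - ε) (by linarith)),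
      hdiff.eventually_const_lt (sub_lt_self _ hε)] with k hk1 hk2
    have hk1' : U x - ε < w (θ k) ((zn ∘ σ) k) := hk1
    have hk3 := hamax k ((zn ∘ σ) k) ⟨hznX (σ k), hznR (σ k)⟩
    linarith
  have hle : U x + ((c * di x' y ^ 2 + 1 * di x' x ^ 2) - (c * di x y ^ 2 + 1 * 0 ^ 2)) ≤
      U x' := by
    by_contra! hlt
    obtain ⟨b, hb1, hb2⟩ := exists_between hlt
    obtain ⟨k, hk1, hk2⟩ :=
      ((hwlow b hb2).and (hupper θ hθlim x' hx' a (fun k => (ha k).1) hlim b hb1)).exists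
    exact lt_asymm hk1 hk2
  have hx'R : dist x' x ≤ R :=
    le_of_tendsto (hlim.dist tendsto_const_nhds) (Eventually.of_forall fun k => (ha k).2)
  obtain rfl : x' = x := by
    by_contra hne
    have := pow_pos (hmeti.pos hx' hx hne) 2
    linarith [hmaxR x' hx' hx'R]
  rw [hmeti.refl x' hx] at hae hwlow
  have hwlim : Tendsto (fun k => w (θ k) (a k)) atTop (𝓝 (U x')) :=
    tendsto_order.2 ⟨fun b hb => hwlow b (by linarith),
      fun b hb => hupper θ hθlim x' hx a (fun k => (ha k).1) hlim b hb⟩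
  have hp0 : ∀ k, 0 ≤ 2 * c * d (θ k) (a k) (f (θ k)) := fun k =>
    mul_nonneg (by positivity) ((hmet _).nonneg (ha k).1 (hfX _))
  have ha0 : ∀ k, 0 ≤ 2 * 1 * d (θ k) (a k) (e (θ k)) := fun k =>
    mul_nonneg (by positivity) ((hmet _).nonneg (ha k).1 (heX _))
  choose q hq0 hqd hqH using fun k =>
    exists_eq_Hlow (hHc (θ k)) (ha k).1 (r := w (θ k) (a k)) (ha0 k) (hp0 k)
  have hHle : ∀ᶠ k in atTop, H (θ k) (a k) (w (θ k) (a k)) (q k) ≤ 0 := by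
    filter_upwards [hlim.eventually (isOpen_ball.mem_nhds (mem_ball_self hR))] with k hk
    rw [hqH]
    have hS := hmet (θ k)
    have hG := hgeo (θ k)
    have key := hsub (θ k) _ _ (isC1MinusWrt_sq hS hG (hfX (θ k)) hc)
      (locLipWrt_sq hS 1 (heX (θ k))) (a k) (ha k).1 (by
        filter_upwards [self_mem_nhdsWithin,
          nhdsWithin_le_nhds (isOpen_ball.mem_nhds hk)] with v hv hv'
        exact hamax k v ⟨hv, ball_subset_closedBall hv'⟩)
    rwa [slopeWrt_sq hS hG (ha k).1 (hfX _) hc,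
      uscWrt_eq_of_continuousOn (continuousOn_slopeWrt_sq hS hG (heX _) zero_le_one) (ha k).1,
      slopeWrt_sq hS hG (ha k).1 (heX _) zero_le_one] at key
  have hqlim : Tendsto q atTop (𝓝 (2 * c * di x' y)) := by
    have h0 : Tendsto (fun k => q k - 2 * c * d (θ k) (a k) (f (θ k))) atTop (𝓝 0) := by
      refine squeeze_zero_norm hqd ?_
      simpa only [mul_zero] using hae.const_mul (2 * 1)
    simpa using h0.add (haf.const_mul (2 * c))
  exact le_of_tendsto (h3 θ hθlim x' hx a (fun k => (ha k).1) hlim _ _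
    (mul_nonneg (by positivity) (hmeti.nonneg hx hy)) _ q hq0 hwlim hqlim) hHle

/-- The upper semilimit of the functions `u n : X n → ℝ`. -/
noncomputable def upperSemilimit (X : ℕ → Set Y) (u : ℕ → Y → ℝ) (x : Y) : ℝ :=
  sSup {L : ℝ | ∃ xn : ℕ → Y, (∀ n, xn n ∈ X n) ∧ Tendsto xn atTop (𝓝 x) ∧
    Filter.limsup (fun n => u n (xn n)) atTop = L}

section UpperSemilimit

variable {u : ℕ → Y → ℝ} {C : ℝ} {x : Y} {xn : ℕ → Y}

theorem limsup_le_upperSemilimit (hbdd : ∀ n, ∀ x ∈ X n, |u n x| ≤ C) (hxn : ∀ n, xn n ∈ X n)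
    (hlim : Tendsto xn atTop (𝓝 x)) :
    limsup (fun n => u n (xn n)) atTop ≤ upperSemilimit X u x := by
  refine le_csSup ⟨C, ?_⟩ ⟨xn, hxn, hlim, rfl⟩
  rintro _ ⟨yn, hyn, -, rfl⟩
  exact (abs_le.1 (abs_limsup_le hbdd hyn)).2

theorem abs_upperSemilimit_le (hbdd : ∀ n, ∀ x ∈ X n, |u n x| ≤ C)
    (hne : ∃ e : ℕ → Y, (∀ n, e n ∈ X n) ∧ Tendsto e atTop (𝓝 x)) :
    |upperSemilimit X u x| ≤ C := by
  obtain ⟨e, he, helim⟩ := hne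
  rw [abs_le]
  refine ⟨(abs_le.1 (abs_limsup_le hbdd he)).1.trans (limsup_le_upperSemilimit hbdd he helim),
    csSup_le ⟨_, e, he, helim, rfl⟩ ?_⟩
  rintro _ ⟨yn, hyn, -, rfl⟩
  exact (abs_le.1 (abs_limsup_le hbdd hyn)).2

theorem eventually_uscWrt_lt_of_upperSemilimit_lt (hbdd : ∀ n, ∀ x ∈ X n, |u n x| ≤ C)
    (hxn : ∀ n, xn n ∈ X n) (hlim : Tendsto xn atTop (𝓝 x)) {c : ℝ}
    (hc : upperSemilimit X u x < c) : ∀ᶠ n in atTop, uscWrt (X n) (u n) (xn n) < c := by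
  have hex : ∀ n : ℕ, ∃ y ∈ X n, dist y (xn n) < 1 / ((n : ℝ) + 1) ∧
      uscWrt (X n) (u n) (xn n) - 1 / ((n : ℝ) + 1) < u n y := fun n => by
    have hpos : 0 < 1 / ((n : ℝ) + 1) := Nat.one_div_pos_of_nat
    obtain ⟨y, hy, hyX, hyd⟩ := ((frequently_lt_of_lt_uscWrt (hbdd n) (hxn n)
      (sub_lt_self _ hpos)).and_eventually (inter_mem_nhdsWithin (X n)
        (ball_mem_nhds _ hpos))).exists
    exact ⟨y, hyX, hyd, hy⟩
  choose yn hyn hyd hyu using hex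
  have h0 : Tendsto (fun n : ℕ => 1 / ((n : ℝ) + 1)) atTop (𝓝 0) :=
    tendsto_one_div_add_atTop_nhds_zero_nat
  have hylim : Tendsto yn atTop (𝓝 x) := by
    refine (tendsto_iff_of_dist (squeeze_zero (fun _ => dist_nonneg) (fun n => ?_) h0)).1 hlim
    rw [dist_comm]
    exact (hyd n).le
  obtain ⟨b, hb, hbc⟩ := exists_between
    ((limsup_le_upperSemilimit hbdd hyn hylim).trans_lt hc)
  filter_upwards [eventually_lt_of_limsup_lt hb (isBoundedUnder_of_eventually_le (a := C)
    (Eventually.of_forall fun n => (abs_le.1 (hbdd n _ (hyn n))).2)),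
    h0.eventually_lt_const (sub_pos.2 hbc)] with n h1 h2
  linarith [hyu n]

theorem exists_subseq_of_uscWrt_upperSemilimit {Xi : Set Y}
    (hbdd : ∀ n, ∀ x ∈ X n, |u n x| ≤ C)
    (happ : ∀ x ∈ Xi, ∃ e : ℕ → Y, (∀ n, e n ∈ X n) ∧ Tendsto e atTop (𝓝 x))
    (hx : x ∈ Xi) {R : ℝ} (hR : 0 < R) :
    ∃ φ : ℕ → ℕ, Tendsto φ atTop atTop ∧ ∃ zn : ℕ → Y,
      (∀ k, zn k ∈ X (φ k)) ∧ (∀ k, dist (zn k) x ≤ R) ∧ Tendsto zn atTop (𝓝 x) ∧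
      ∀ c < uscWrt Xi (upperSemilimit X u) x,
        ∀ᶠ k in atTop, c < uscWrt (X (φ k)) (u (φ k)) (zn k) := by
  set U := uscWrt Xi (upperSemilimit X u) x with hU
  have hbar : ∀ y ∈ Xi, |upperSemilimit X u y| ≤ C := fun y hy =>
    abs_upperSemilimit_le hbdd (happ y hy)
  have hex : ∀ k : ℕ, ∃ n ≥ k, ∃ z ∈ X n, dist z x ≤ R * (1 / ((k : ℝ) + 1)) ∧
      U - 1 / ((k : ℝ) + 1) < uscWrt (X n) (u n) z := fun k => by
    have hpos : 0 < 1 / ((k : ℝ) + 1) := Nat.one_div_pos_of_nat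
    set δ := R * (1 / ((k : ℝ) + 1)) / 2 with hδ
    have hδpos : 0 < δ := by positivity
    obtain ⟨y, hy, hyX, hyd⟩ := ((frequently_lt_of_lt_uscWrt hbar hx
      (sub_lt_self _ hpos)).and_eventually (inter_mem_nhdsWithin Xi
        (ball_mem_nhds _ hδpos))).exists
    obtain ⟨e, he, helim⟩ := happ y hyX
    have hne : {L : ℝ | ∃ yn : ℕ → Y, (∀ n, yn n ∈ X n) ∧ Tendsto yn atTop (𝓝 y) ∧
        limsup (fun n => u n (yn n)) atTop = L}.Nonempty := ⟨_, e, he, helim, rfl⟩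
    obtain ⟨_, ⟨yn, hyn, hylim, rfl⟩, hlt⟩ := exists_lt_of_lt_csSup hne hy
    have hfr := frequently_lt_of_lt_limsup (isCoboundedUnder_le_of_eventually_le _ (x := -C)
      (Eventually.of_forall fun n => (abs_le.1 (hbdd n _ (hyn n))).1)) hlt
    obtain ⟨n, hn, hnk, hnd⟩ := (hfr.and_eventually ((eventually_ge_atTop k).and
      (hylim.eventually (ball_mem_nhds _ hδpos)))).exists
    refine ⟨n, hnk, yn n, hyn n, ?_, hn.trans_le (le_uscWrt (hbdd n) (hyn n))⟩
    have h1 := dist_triangle (yn n) y x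
    have h2 : dist (yn n) y < δ := hnd
    have h3 : dist y x < δ := hyd
    linarith
  choose φ hφ zn hzn hzd hzu using hex
  have h0 : Tendsto (fun n : ℕ => 1 / ((n : ℝ) + 1)) atTop (𝓝 0) :=
    tendsto_one_div_add_atTop_nhds_zero_nat
  refine ⟨φ, tendsto_atTop_mono hφ tendsto_id, zn, hzn, fun k => (hzd k).trans ?_, ?_, ?_⟩
  · refine mul_le_of_le_one_right hR.le ?_
    rw [div_le_one (by positivity)]
    linarith [Nat.cast_nonneg (α := ℝ) k]
  · refine tendsto_iff_dist_tendsto_zero.2 (squeeze_zero (fun _ => dist_nonneg) hzd ?_)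
    simpa using h0.const_mul R
  · intro c hc
    filter_upwards [h0.eventually_lt_const (sub_pos.2 hc)] with k hk
    linarith [hzu k]

end UpperSemilimit

end Stability


/-- stability of metric viscosity subsolutions under Hausdorff convergence
(compact case). -/
theorem stmt8 {Y : Type*} [MetricSpace Y] [LocallyCompactSpace Y]
    (X : ℕ → Set Y) (Xi : Set Y)
    (d : ℕ → Y → Y → ℝ) (di : Y → Y → ℝ)
    (H : ℕ → Y → ℝ → ℝ → ℝ) (Hi : Y → ℝ → ℝ → ℝ)
    (u : ℕ → Y → ℝ)
    (hXne : ∀ n, (X n).Nonempty) (hXc : ∀ n, IsCompact (X n))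
    (hXine : Xi.Nonempty) (hXic : IsCompact Xi)
    (hmet : ∀ n, IsMetricOn (X n) (d n)) (hgeo : ∀ n, IsGeodesicWrt (X n) (d n))
    (hmeti : IsMetricOn Xi di) (hgeoi : IsGeodesicWrt Xi di)
    (hHc : ∀ n, ContinuousOn (fun q : Y × ℝ × ℝ => H n q.1 q.2.1 q.2.2)
      (X n ×ˢ (univ : Set ℝ) ×ˢ Ici (0:ℝ)))
    (hHic : ContinuousOn (fun q : Y × ℝ × ℝ => Hi q.1 q.2.1 q.2.2)
      (Xi ×ˢ (univ : Set ℝ) ×ˢ Ici (0:ℝ)))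
    (h1 : Tendsto (fun n => hausdorffDist (X n) Xi) atTop (𝓝 0))
    (h2 : ∀ a ∈ Xi, ∀ b ∈ Xi, ∀ an bn : ℕ → Y, (∀ n, an n ∈ X n) → (∀ n, bn n ∈ X n) →
      Tendsto an atTop (𝓝 a) → Tendsto bn atTop (𝓝 b) →
      Tendsto (fun n => d n (an n) (bn n)) atTop (𝓝 (di a b)))
    (h3 : ∀ x ∈ Xi, ∀ xn : ℕ → Y, (∀ n, xn n ∈ X n) → Tendsto xn atTop (𝓝 x) →
      ∀ r p : ℝ, 0 ≤ p → ∀ rn pn : ℕ → ℝ, (∀ n, 0 ≤ pn n) →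
      Tendsto rn atTop (𝓝 r) → Tendsto pn atTop (𝓝 p) →
      Tendsto (fun n => H n (xn n) (rn n) (pn n)) atTop (𝓝 (Hi x r p)))
    (hsub : ∀ n, IsMVSubsolutionWrt (X n) (d n) (H n) (u n))
    (hbdd : ∃ C : ℝ, ∀ n, ∀ x ∈ X n, |u n x| ≤ C) :
    IsMVSubsolutionWrt Xi di Hi (fun x => sSup {L : ℝ | ∃ xn : ℕ → Y,
      (∀ n, xn n ∈ X n) ∧ Tendsto xn atTop (𝓝 x) ∧
      Filter.limsup (fun n => u n (xn n)) atTop = L}) := by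
  obtain ⟨C, hC⟩ := hbdd
  have happ := fun x (hx : x ∈ Xi) => exists_seq_tendsto_of_hausdorffDist hXne hXc hXic h1 hx
  have hbar : ∀ y ∈ Xi, |upperSemilimit X u y| ≤ C := fun y hy =>
    abs_upperSemilimit_le hC (happ y hy)
  intro ψ₁ ψ₂ hψ₁ hψ₂ x hx hmax
  refine Hlow_le_of_quadratic_tests (U := uscWrt Xi (upperSemilimit X u)) hXic hmeti hgeoi hHic
    (fun y hy => abs_uscWrt_le hbar hy) (upperSemicontinuousOn_uscWrt hbar) ?_ hψ₁ hψ₂ hx hmax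
  intro k hk x hx y hy hxy
  refine le_zero_of_quadratic_test hXc hXine hXic hmet hgeo hmeti hHc h1 happ ?_ ?_ hsub hC ?_
    (fun x hx R hR => exists_subseq_of_uscWrt_upperSemilimit hC happ hx hR) hk hx hy hxy
  · intro φ hφ a ha b hb an bn han hbn hlima hlimb
    obtain ⟨e, he, helim⟩ := happ a ha
    obtain ⟨f, hf, hflim⟩ := happ b hb
    exact tendsto_subseq_of_forall_seq (A := fun n => X n ×ˢ X n) (z₀ := (a, b))
      (e := fun n => (e n, f n)) (F := fun n z => d n z.1 z.2) (fun n => ⟨he n, hf n⟩)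
      (helim.prodMk_nhds hflim)
      (fun z hz hzlim => h2 a ha b hb _ _ (fun n => (hz n).1) (fun n => (hz n).2)
        ((continuous_fst.tendsto _).comp hzlim) ((continuous_snd.tendsto _).comp hzlim))
      hφ (z := fun k => (an k, bn k)) (fun k => ⟨han k, hbn k⟩) (hlima.prodMk_nhds hlimb)
  · intro φ hφ x hx xn hxn hlim r p hp rn pn hpn hrlim hplim
    obtain ⟨e, he, helim⟩ := happ x hx
    exact tendsto_subseq_of_forall_seq
      (A := fun n => X n ×ˢ (univ : Set ℝ) ×ˢ Ici (0 : ℝ)) (z₀ := (x, r, p))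
      (e := fun n => (e n, r, p)) (F := fun n z => H n z.1 z.2.1 z.2.2)
      (fun n => ⟨he n, mem_univ _, hp⟩)
      (helim.prodMk_nhds tendsto_const_nhds)
      (fun z hz hzlim => h3 x hx _ (fun n => (hz n).1)
        ((continuous_fst.tendsto _).comp hzlim) r p hp _ _ (fun n => (hz n).2.2)
        ((continuous_fst.tendsto _).comp ((continuous_snd.tendsto _).comp hzlim))
        ((continuous_snd.tendsto _).comp ((continuous_snd.tendsto _).comp hzlim)))
      hφ (z := fun k => (xn k, rn k, pn k)) (fun k => ⟨hxn k, mem_univ _, hpn k⟩)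
      (hlim.prodMk_nhds (hrlim.prodMk_nhds hplim))
  · intro φ hφ x hx xn hxn hlim c hc
    obtain ⟨e, he, helim⟩ := happ x hx
    refine tendsto_principal.1 (tendsto_subseq_of_forall_seq (l := 𝓟 (Iio c)) he helim
      (F := fun n z => uscWrt (X n) (u n) z) (fun z hz hzlim => tendsto_principal.2 ?_)
      hφ hxn hlim)
    exact eventually_uscWrt_lt_of_upperSemilimit_lt hC hz hzlim
      ((le_uscWrt hbar hx).trans_lt hc)
end
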